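/- arXiv:math/0702549 — 5 statements merged into one kernel-verified Lean document; each statement's English description precedes it below -/
import Mathlib

section
/- For each integer r with 2 ≤ r ≤ 8, the set of (−1)-classes in ℤ^{r+1} is finite, and its cardinality N_r is given by N_2 = 3, N_3 = 6, N_4 = 10, N_5 = 16, N_6 = 27, N_7 = 56, N_8 = 240. -/
open scoped BigOperators
open MeasureTheory

/-- Intersection form on `ℤ^(n+1)` with basis `H, E₁, …, E_n`:
`B(x,y) = x₀y₀ - x₁y₁ - ⋯ - x_n y_n` (written as `2x₀y₀ - ∑ᵢ xᵢyᵢ`). -/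
def interZ {n : ℕ} (x y : Fin (n + 1) → ℤ) : ℤ :=
  2 * x 0 * y 0 - ∑ i, x i * y i

/-- The real intersection form on `ℝ^(n+1)`. -/
def interR {n : ℕ} (x y : Fin (n + 1) → ℝ) : ℝ :=
  2 * x 0 * y 0 - ∑ i, x i * y i

/-- The anticanonical class `-K = (3, -1, …, -1)`. -/
def antiK (n : ℕ) : Fin (n + 1) → ℤ := fun i => if i = 0 then 3 else -1

/-- The anticanonical class as a real vector. -/
def antiKR (n : ℕ) : Fin (n + 1) → ℝ := fun i => if i = 0 then 3 else -1

/-- A `(-1)`-class: `B(E,E) = -1` and `B(-K,E) = 1`. -/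
def IsMinusOneClass {n : ℕ} (E : Fin (n + 1) → ℤ) : Prop :=
  interZ E E = -1 ∧ interZ (antiK n) E = 1

/-- The nef cone: real vectors pairing nonnegatively with every `(-1)`-class. -/
def NefCone (n : ℕ) : Set (Fin (n + 1) → ℝ) :=
  {x | ∀ E : Fin (n + 1) → ℤ, IsMinusOneClass E → 0 ≤ interR (fun i => (E i : ℝ)) x}

/-- The number of `(-1)`-classes `N_r` for `2 ≤ r ≤ 8`. -/
def numMinusOne (r : ℕ) : ℕ :=
  if r = 2 then 3 else if r = 3 then 6 else if r = 4 then 10 else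
  if r = 5 then 16 else if r = 6 then 27 else if r = 7 then 56 else 240

/-- The number of `x : Fin n → ℤ` with `∑ xᵢ = s` and `∑ xᵢ² = q`, computed by fixing the
coordinates one by one and discarding the branches excluded by Cauchy–Schwarz. -/
noncomputable def countSumSq : ℕ → ℤ → ℤ → ℕ
  | 0, s, q => if s = 0 ∧ q = 0 then 1 else 0
  | n + 1, s, q =>
    if s ^ 2 ≤ (n + 1 : ℕ) * q then
      ∑ a ∈ Finset.Icc (-q) q, countSumSq n (s - a) (q - a ^ 2)
    else 0

/-- Counting the vectors satisfying `P` by their first coordinate. -/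
theorem encard_eq_sum_encard_cons {α : Type*} {n : ℕ} (P : (Fin (n + 1) → α) → Prop)
    (t : Finset α) (ht : ∀ x, P x → x 0 ∈ t) :
    {x | P x}.encard = ∑ a ∈ t, {y : Fin n → α | P (Fin.cons a y)}.encard := by
  classical
  induction t using Finset.induction_on generalizing P with
  | empty =>
    have : {x | P x} = ∅ := Set.eq_empty_of_forall_notMem fun x hx => by simpa using ht x hx
    simp [this]
  | insert a t ha ih =>
    have hsplit : {x | P x} =
        (Fin.cons (α := fun _ => α) a '' {y : Fin n → α | P (Fin.cons a y)}) ∪ {x | P x ∧ x 0 ≠ a} := by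
      ext x
      constructor
      · intro h
        by_cases hx : x 0 = a
        · subst hx
          exact Or.inl ⟨Fin.tail x, by simpa using h, by simp⟩
        · exact Or.inr ⟨h, hx⟩
      · rintro (⟨y, hy, rfl⟩ | h)
        · exact hy
        · exact h.1
    have hdisj : Disjoint (Fin.cons (α := fun _ => α) a '' {y : Fin n → α | P (Fin.cons a y)})
        {x | P x ∧ x 0 ≠ a} := by
      rw [Set.disjoint_left]
      rintro _ ⟨y, -, rfl⟩ h
      exact h.2 (by simp)
    rw [hsplit, Set.encard_union_eq hdisj, (Fin.cons_right_injective (α := fun _ => α) a).encard_image,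
      Finset.sum_insert ha, ih (fun x => P x ∧ x 0 ≠ a)
        fun x hx => (Finset.mem_insert.1 (ht x hx.1)).resolve_left hx.2]
    congr 1
    refine Finset.sum_congr rfl fun b hb => ?_
    have hba : b ≠ a := fun h => ha (h ▸ hb)
    simp [hba]

theorem encard_sum_sumSq_eq (n : ℕ) (s q : ℤ) :
    {x : Fin n → ℤ | ∑ i, x i = s ∧ ∑ i, x i ^ 2 = q}.encard = countSumSq n s q := by
  induction n generalizing s q with
  | zero =>
    by_cases h : s = 0 ∧ q = 0
    · simp [countSumSq, h]
    · have h' : ¬(0 = s ∧ 0 = q) := fun e => h ⟨e.1.symm, e.2.symm⟩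
      simp [countSumSq, h, h']
  | succ n ih =>
    rw [countSumSq]
    split_ifs with h
    · rw [encard_eq_sum_encard_cons _ (Finset.Icc (-q) q), Nat.cast_sum]
      · refine Finset.sum_congr rfl fun a _ => ?_
        rw [← ih]
        simp only [Fin.sum_univ_succ, Fin.cons_zero, Fin.cons_succ, eq_sub_iff_add_eq']
      · rintro x ⟨-, hq⟩
        have hx : x 0 ^ 2 ≤ q := hq ▸ Finset.single_le_sum (f := fun i => x i ^ 2)
          (fun i _ => sq_nonneg (x i)) (Finset.mem_univ 0)
        have hpos := Int.le_self_sq (x 0)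
        have hneg := Int.le_self_sq (-x 0)
        rw [neg_sq] at hneg
        exact Finset.mem_Icc.2 ⟨by linarith, by linarith⟩
    · rw [Nat.cast_zero, Set.encard_eq_zero]
      refine Set.eq_empty_of_forall_notMem ?_
      rintro x ⟨rfl, rfl⟩
      exact h (by simpa using sq_sum_le_card_mul_sum_sq (s := Finset.univ) (f := x))

theorem isMinusOneClass_iff {n : ℕ} (E : Fin (n + 1) → ℤ) :
    IsMinusOneClass E ↔ ∑ i : Fin n, E i.succ = 1 - 3 * E 0 ∧
      ∑ i : Fin n, E i.succ ^ 2 = E 0 ^ 2 + 1 := by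
  have hself : interZ E E = E 0 ^ 2 - ∑ i : Fin n, E i.succ ^ 2 := by
    simp only [interZ, Fin.sum_univ_succ, ← pow_two]
    ring
  have hanti : interZ (antiK n) E = 3 * E 0 + ∑ i : Fin n, E i.succ := by
    simp only [interZ, antiK, Fin.sum_univ_succ, Fin.succ_ne_zero, if_true, if_false,
      neg_one_mul, Finset.sum_neg_distrib]
    ring
  rw [IsMinusOneClass, hself, hanti]
  constructor <;> rintro ⟨h₁, h₂⟩ <;> constructor <;> linarith

/-- For `n ≤ 8` the degree of a `(-1)`-class lies between `-1` and `7`. -/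
theorem IsMinusOneClass.degree_mem_Icc {n : ℕ} (hn : n ≤ 8) {E : Fin (n + 1) → ℤ}
    (hE : IsMinusOneClass E) : E 0 ∈ Finset.Icc (-1) 7 := by
  obtain ⟨hs, hq⟩ := (isMinusOneClass_iff E).1 hE
  have hcs := sq_sum_le_card_mul_sum_sq (s := Finset.univ) (f := fun i : Fin n => E i.succ)
  rw [hs, hq, Finset.card_univ, Fintype.card_fin] at hcs
  have hn' : (n : ℤ) ≤ 8 := by exact_mod_cast hn
  have h8 : (1 - 3 * E 0) ^ 2 ≤ 8 * (E 0 ^ 2 + 1) :=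
    hcs.trans (mul_le_mul_of_nonneg_right hn' (by positivity))
  exact Finset.mem_Icc.2 ⟨by nlinarith, by nlinarith⟩

theorem encard_minusOneClasses {n : ℕ} (hn : n ≤ 8) :
    {E : Fin (n + 1) → ℤ | IsMinusOneClass E}.encard =
      (∑ d ∈ Finset.Icc (-1 : ℤ) 7, countSumSq n (1 - 3 * d) (d ^ 2 + 1) : ℕ) := by
  rw [encard_eq_sum_encard_cons _ (Finset.Icc (-1) 7) fun E hE => hE.degree_mem_Icc hn,
    Nat.cast_sum]
  refine Finset.sum_congr rfl fun d _ => ?_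
  rw [← encard_sum_sumSq_eq]
  simp only [isMinusOneClass_iff, Fin.cons_zero, Fin.cons_succ]

theorem sum_countSumSq_eq_numMinusOne (r : ℕ) (h2 : 2 ≤ r) (h8 : r ≤ 8) :
    ∑ d ∈ Finset.Icc (-1 : ℤ) 7, countSumSq r (1 - 3 * d) (d ^ 2 + 1) = numMinusOne r := by
  interval_cases r <;> decide +kernel

theorem minusOneClasses_finite_card (r : ℕ) (h2 : 2 ≤ r) (h8 : r ≤ 8) :
    {E : Fin (r + 1) → ℤ | IsMinusOneClass E}.Finite ∧
    {E : Fin (r + 1) → ℤ | IsMinusOneClass E}.ncard = numMinusOne r := by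
  have h := encard_minusOneClasses h8
  rw [sum_countSumSq_eq_numMinusOne r h2 h8] at h
  exact ⟨Set.finite_of_encard_eq_coe h, by rw [Set.ncard, h, ENat.toNat_natCast]⟩
end

section
/- Let r be an integer with 3 ≤ r ≤ 8 and let E, E' be (−1)-classes in ℤ^{r+1} with B(E,E') ≥ 1. Then there exist (−1)-classes E_1, E_2 with E + E' = E_1 + E_2, E ≠ E_1, and E ≠ E_2. -/
open scoped BigOperators
open MeasureTheory

section IntersectionForm

variable {n : ℕ}

lemma interZ_comm (x y : Fin (n + 1) → ℤ) : interZ x y = interZ y x := by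
  simp only [interZ, mul_comm, mul_left_comm]

lemma interZ_add_left (x y z : Fin (n + 1) → ℤ) :
    interZ (x + y) z = interZ x z + interZ y z := by
  simp only [interZ, Pi.add_apply, add_mul, Finset.sum_add_distrib]
  ring

lemma interZ_smul_left (c : ℤ) (x z : Fin (n + 1) → ℤ) :
    interZ (c • x) z = c * interZ x z := by
  simp only [interZ, Pi.smul_apply, smul_eq_mul, mul_assoc, ← Finset.mul_sum]
  ring

lemma interZ_sub_left (x y z : Fin (n + 1) → ℤ) :
    interZ (x - y) z = interZ x z - interZ y z := by
  simp only [interZ, Pi.sub_apply, sub_mul, Finset.sum_sub_distrib]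
  ring

lemma interZ_add_right (x y z : Fin (n + 1) → ℤ) :
    interZ x (y + z) = interZ x y + interZ x z := by
  rw [interZ_comm, interZ_add_left, interZ_comm y, interZ_comm z]

lemma interZ_smul_right (c : ℤ) (x z : Fin (n + 1) → ℤ) :
    interZ x (c • z) = c * interZ x z := by
  rw [interZ_comm, interZ_smul_left, interZ_comm z]

lemma interZ_sub_right (x y z : Fin (n + 1) → ℤ) :
    interZ x (y - z) = interZ x y - interZ x z := by
  rw [interZ_comm, interZ_sub_left, interZ_comm y, interZ_comm z]

/-- The class `H` of a line. -/
def lineClass (n : ℕ) : Fin (n + 1) → ℤ := Pi.single 0 1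

/-- The class of the exceptional curve over the `i`-th point. -/
def excClass (i : Fin n) : Fin (n + 1) → ℤ := Pi.single i.succ 1

@[simp] lemma lineClass_zero : lineClass n 0 = 1 := by simp [lineClass]

@[simp] lemma lineClass_succ (i : Fin n) : lineClass n i.succ = 0 := by
  simp [lineClass]

@[simp] lemma excClass_zero (i : Fin n) : excClass i 0 = 0 := by
  simp [excClass, (Fin.succ_ne_zero i).symm]

lemma excClass_succ (i j : Fin n) : excClass i j.succ = if j = i then 1 else 0 := by
  simp [excClass, Pi.single_apply]

@[simp] lemma interZ_lineClass (x : Fin (n + 1) → ℤ) : interZ (lineClass n) x = x 0 := by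
  simp only [interZ, Fin.sum_univ_succ, lineClass_zero, lineClass_succ, zero_mul,
    Finset.sum_const_zero]
  ring

@[simp] lemma interZ_excClass (i : Fin n) (x : Fin (n + 1) → ℤ) :
    interZ (excClass i) x = -x i.succ := by
  simp [interZ, Fin.sum_univ_succ, excClass_succ]

@[simp] lemma antiK_zero : antiK n 0 = 3 := rfl

@[simp] lemma antiK_succ (i : Fin n) : antiK n i.succ = -1 := by simp [antiK]

/-- A root of the Picard lattice: a class of square `-2` orthogonal to the canonical class. -/
def IsRootClass (α : Fin (n + 1) → ℤ) : Prop :=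
  interZ α α = -2 ∧ interZ (antiK n) α = 0

lemma isRootClass_exc_sub_exc {i j : Fin n} (hij : i ≠ j) :
    IsRootClass (excClass i - excClass j) := by
  constructor
  · simp [interZ_sub_left, excClass_succ, hij, hij.symm]
  · rw [interZ_comm]; simp [interZ_sub_left]

lemma isRootClass_cremona {i j k : Fin n} (hij : i ≠ j) (hik : i ≠ k) (hjk : j ≠ k) :
    IsRootClass (lineClass n - excClass i - excClass j - excClass k) := by
  constructor
  · simp [interZ_sub_left, excClass_succ, hij, hik, hjk, hij.symm, hik.symm, hjk.symm]
  · rw [interZ_comm]; simp [interZ_sub_left]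

/-- The reflection in the root `α`. -/
def rootReflection (α x : Fin (n + 1) → ℤ) : Fin (n + 1) → ℤ := x + interZ α x • α

lemma interZ_rootReflection {α : Fin (n + 1) → ℤ} (hα : IsRootClass α)
    (x y : Fin (n + 1) → ℤ) :
    interZ (rootReflection α x) (rootReflection α y) = interZ x y := by
  simp only [rootReflection, interZ_add_left, interZ_add_right, interZ_smul_left,
    interZ_smul_right, hα.1, interZ_comm x α]
  ring

lemma interZ_antiK_rootReflection {α : Fin (n + 1) → ℤ} (hα : IsRootClass α)
    (x : Fin (n + 1) → ℤ) :
    interZ (antiK n) (rootReflection α x) = interZ (antiK n) x := by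
  rw [rootReflection, interZ_add_right, interZ_smul_right, hα.2, mul_zero, add_zero]

lemma rootReflection_rootReflection {α : Fin (n + 1) → ℤ} (hα : IsRootClass α)
    (x : Fin (n + 1) → ℤ) : rootReflection α (rootReflection α x) = x := by
  simp only [rootReflection, interZ_add_right, interZ_smul_right, hα.1]
  module

lemma IsMinusOneClass.rootReflection {α E : Fin (n + 1) → ℤ} (hE : IsMinusOneClass E)
    (hα : IsRootClass α) : IsMinusOneClass (rootReflection α E) :=
  ⟨by rw [interZ_rootReflection hα, hE.1], by rw [interZ_antiK_rootReflection hα, hE.2]⟩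

lemma IsRootClass.rootReflection {α β : Fin (n + 1) → ℤ} (hβ : IsRootClass β)
    (hα : IsRootClass α) : IsRootClass (rootReflection α β) :=
  ⟨by rw [interZ_rootReflection hα, hβ.1], by rw [interZ_antiK_rootReflection hα, hβ.2]⟩

/-- Some root pairs to `1` with `E` and to `-1` with `E'`. -/
def HasSeparatingRoot (E E' : Fin (n + 1) → ℤ) : Prop :=
  ∃ α, IsRootClass α ∧ interZ α E = 1 ∧ interZ α E' = -1

lemma HasSeparatingRoot.of_rootReflection {α E E' : Fin (n + 1) → ℤ} (hα : IsRootClass α)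
    (h : HasSeparatingRoot (rootReflection α E) (rootReflection α E')) :
    HasSeparatingRoot E E' := by
  obtain ⟨β, hβ, h1, h2⟩ := h
  refine ⟨rootReflection α β, hβ.rootReflection hα, ?_, ?_⟩
  · rw [← h1, ← interZ_rootReflection hα, rootReflection_rootReflection hα]
  · rw [← h2, ← interZ_rootReflection hα, rootReflection_rootReflection hα]

lemma HasSeparatingRoot.exists_decomposition {E E' : Fin (n + 1) → ℤ}
    (h : HasSeparatingRoot E E') (hE : IsMinusOneClass E) (hE' : IsMinusOneClass E')
    (hpos : 1 ≤ interZ E E') :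
    ∃ E₁ E₂ : Fin (n + 1) → ℤ, IsMinusOneClass E₁ ∧ IsMinusOneClass E₂ ∧
      E + E' = E₁ + E₂ ∧ E ≠ E₁ ∧ E ≠ E₂ := by
  obtain ⟨α, hα, h1, h2⟩ := h
  refine ⟨E + α, E' - α, ⟨?_, ?_⟩, ⟨?_, ?_⟩, by abel, fun h => ?_, fun h => ?_⟩
  · simp only [interZ_add_left, interZ_add_right, hE.1, hα.1, h1, interZ_comm E α]; norm_num
  · simp only [interZ_add_right, hE.2, hα.2]; norm_num
  · simp only [interZ_sub_left, interZ_sub_right, hE'.1, hα.1, h2, interZ_comm E' α]; norm_num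
  · simp only [interZ_sub_right, hE'.2, hα.2]; norm_num
  · have h0 := congrArg (interZ α) h
    rw [interZ_add_right, hα.1] at h0
    omega
  · have h0 := congrArg (fun x => interZ x E') h
    simp only [interZ_sub_left, hE'.1, h2] at h0
    omega

end IntersectionForm

section Enumeration

/-- The nondecreasing integer vectors of length `n` with smallest entry at least `a`, successive
increments at most `14`, sum `s` and sum of squares `q`. -/
def monotoneVectors : (n : ℕ) → ℤ → ℤ → ℤ → List (Fin n → ℤ)
  | 0, _, s, q => if s = 0 ∧ q = 0 then [Fin.elim0] else []
  | n + 1, a, s, q =>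
    if s * s ≤ (n + 1 : ℕ) * q ∧ (n + 1 : ℕ) * a ≤ s then
      (List.range 15).flatMap fun t : ℕ =>
        (monotoneVectors n (a + t) (s - (a + t)) (q - (a + t) * (a + t))).map
          (Fin.cons (a + (t : ℤ)))
    else []

lemma mem_monotoneVectors (n : ℕ) (a : ℤ) (v : Fin n → ℤ) (hv : Monotone v) (ha : -7 ≤ a)
    (hav : ∀ i, a ≤ v i) (h : ∑ i, v i * v i < 64) :
    v ∈ monotoneVectors n a (∑ i, v i) (∑ i, v i * v i) := by
  induction n generalizing a with
  | zero => simp [monotoneVectors]; exact Subsingleton.elim _ _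
  | succ n ih =>
    have hcs : (∑ i, v i) * (∑ i, v i) ≤ (n + 1 : ℕ) * ∑ i, v i * v i := by
      simpa [sq] using sq_sum_le_card_mul_sum_sq (s := Finset.univ) (f := v)
    have hle : (n + 1 : ℕ) * a ≤ ∑ i, v i := by
      simpa using Finset.card_nsmul_le_sum Finset.univ v a fun i _ => hav i
    rw [monotoneVectors, if_pos ⟨hcs, hle⟩]
    simp only [Fin.sum_univ_succ] at h ⊢
    have hnn : 0 ≤ ∑ i : Fin n, v i.succ * v i.succ :=
      Finset.sum_nonneg fun i _ => mul_self_nonneg _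
    have hhi : v 0 ≤ 7 := by nlinarith
    have ht := ih (v 0) (Fin.tail v) (fun i j hij => hv (Fin.succ_le_succ_iff.2 hij))
      (ha.trans (hav 0)) (fun i => hv (Fin.zero_le _)) (by
        have := mul_self_nonneg (v 0)
        simp only [Fin.tail]
        linarith)
    obtain ⟨t, hat⟩ : ∃ t : ℕ, a + (t : ℤ) = v 0 :=
      ⟨(v 0 - a).toNat, by rw [Int.toNat_of_nonneg (sub_nonneg.2 (hav 0))]; ring⟩
    refine List.mem_flatMap.2 ⟨t, List.mem_range.2 (by lia), ?_⟩
    rw [hat, add_sub_cancel_left, add_sub_cancel_left]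
    exact List.mem_map.2 ⟨Fin.tail v, ht, Fin.cons_self_tail v⟩

/-- The combinatorial properties of a `(-1)`-class with coefficients `d` on `H` and `v i` on `Eᵢ`
that drive the reduction by Cremona reflections. -/
def IsCremonaReducible {r : ℕ} (d : ℤ) (v : Fin r → ℤ) : Prop :=
  0 ≤ d ∧
  (d = 0 → ∃ i, v i = 1 ∧ ∀ j, j ≠ i → v j = 0) ∧
  (0 < d → ∃ i j, i ≠ j ∧ ∃ k, i ≠ k ∧ j ≠ k ∧ d + v i + v j + v k < 0) ∧
  ∀ i, v i < 0 → (∃ j, v j = v i + 1) ∨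
    (∃ j, i ≠ j ∧ ∃ k, i ≠ k ∧ j ≠ k ∧ d + v i + v j + v k = -1) ∨
    ∃ j, i ≠ j ∧ ∃ k, i ≠ k ∧ j ≠ k ∧ ∃ l, i ≠ l ∧ j ≠ l ∧ k ≠ l ∧ d + v j + v k + v l < 0

lemma IsCremonaReducible.of_comp_perm {r : ℕ} {d : ℤ} {v : Fin r → ℤ} (σ : Equiv.Perm (Fin r))
    (h : IsCremonaReducible d (v ∘ σ)) : IsCremonaReducible d v := by
  obtain ⟨h0, h1, h2, h3⟩ := h
  refine ⟨h0, fun hd => ?_, fun hd => ?_, σ.surjective.forall.2 fun i hi => ?_⟩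
  · obtain ⟨i, hi, hi'⟩ := h1 hd
    exact ⟨σ i, hi, σ.surjective.forall.2 fun j hj => hi' j (σ.injective.ne_iff.1 hj)⟩
  · obtain ⟨i, j, hij, k, hik, hjk, hs⟩ := h2 hd
    exact ⟨σ i, σ j, σ.injective.ne hij, σ k, σ.injective.ne hik, σ.injective.ne hjk, hs⟩
  · obtain ⟨j, hj⟩ | ⟨j, hij, k, hik, hjk, hs⟩ | ⟨j, hij, k, hik, hjk, l, hil, hjl, hkl, hs⟩ :=
      h3 i hi
    · exact .inl ⟨σ j, hj⟩
    · exact .inr (.inl ⟨σ j, σ.injective.ne hij, σ k, σ.injective.ne hik, σ.injective.ne hjk, hs⟩)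
    · exact .inr (.inr ⟨σ j, σ.injective.ne hij, σ k, σ.injective.ne hik, σ.injective.ne hjk,
        σ l, σ.injective.ne hil, σ.injective.ne hjl, σ.injective.ne hkl, hs⟩)

set_option synthInstance.maxSize 1000 in
set_option synthInstance.maxHeartbeats 200000 in
instance {r : ℕ} (d : ℤ) (v : Fin r → ℤ) : Decidable (IsCremonaReducible d v) := by
  unfold IsCremonaReducible
  infer_instance

lemma isCremonaReducible_of_mem_monotoneVectors :
    ∀ r ∈ [3, 4, 5, 6, 7, 8], ∀ d ∈ ([-1, 0, 1, 2, 3, 4, 5, 6, 7] : List ℤ),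
      ∀ v ∈ monotoneVectors r (-7) (1 - 3 * d) (d * d + 1), IsCremonaReducible d v := by
  decide +kernel

lemma isCremonaReducible_of_sums {r : ℕ} (h3 : 3 ≤ r) (h8 : r ≤ 8) {d : ℤ} {v : Fin r → ℤ}
    (hs : ∑ i, v i = 1 - 3 * d) (hq : ∑ i, v i * v i = d * d + 1) :
    IsCremonaReducible d v := by
  have hcs : (∑ i, v i) ^ 2 ≤ r * ∑ i, v i ^ 2 := by
    simpa using sq_sum_le_card_mul_sum_sq (s := Finset.univ) (f := v)
  simp only [sq, hs, hq] at hcs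
  have hr : (r : ℤ) ≤ 8 := by exact_mod_cast h8
  have hb : (d + 1) * (d - 7) ≤ 0 := by
    nlinarith [mul_le_mul_of_nonneg_right hr (by nlinarith : 0 ≤ d * d + 1)]
  have hlo : -1 ≤ d := by nlinarith
  have hhi : d ≤ 7 := by nlinarith
  have hlt : d * d + 1 < 64 := by nlinarith
  refine .of_comp_perm (Tuple.sort v) ?_
  have hs' : ∑ i, (v ∘ Tuple.sort v) i = 1 - 3 * d := by
    rw [← hs]; exact Equiv.sum_comp (Tuple.sort v) v
  have hq' : ∑ i, (v ∘ Tuple.sort v) i * (v ∘ Tuple.sort v) i = d * d + 1 := by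
    rw [← hq]; exact Equiv.sum_comp (Tuple.sort v) fun i => v i * v i
  have hmem := mem_monotoneVectors r (-7) (v ∘ Tuple.sort v) (Tuple.monotone_sort v) le_rfl
    (fun i => by
      have hi := Finset.single_le_sum (f := fun i => v i * v i) (fun j _ => mul_self_nonneg (v j))
        (Finset.mem_univ (Tuple.sort v i))
      simp only [Function.comp_apply]
      nlinarith)
    (hq'.trans_lt hlt)
  rw [hs', hq'] at hmem
  refine isCremonaReducible_of_mem_monotoneVectors r ?_ d ?_ _ hmem
  · simp only [List.mem_cons, List.not_mem_nil]; omega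
  · simp only [List.mem_cons, List.not_mem_nil]; omega

end Enumeration

section Classes

variable {r : ℕ}

lemma IsMinusOneClass.sum_eq {E : Fin (r + 1) → ℤ} (hE : IsMinusOneClass E) :
    ∑ i : Fin r, E i.succ = 1 - 3 * E 0 := by
  have h := hE.2
  simp only [interZ, Fin.sum_univ_succ, antiK_zero, antiK_succ, neg_one_mul,
    Finset.sum_neg_distrib] at h
  linarith

lemma IsMinusOneClass.sum_mul_self_eq {E : Fin (r + 1) → ℤ} (hE : IsMinusOneClass E) :
    ∑ i : Fin r, E i.succ * E i.succ = E 0 * E 0 + 1 := by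
  have h := hE.1
  simp only [interZ, Fin.sum_univ_succ] at h
  linarith

lemma IsMinusOneClass.isCremonaReducible {E : Fin (r + 1) → ℤ} (hE : IsMinusOneClass E)
    (h3 : 3 ≤ r) (h8 : r ≤ 8) :
    IsCremonaReducible (E 0) fun i : Fin r => E i.succ :=
  isCremonaReducible_of_sums h3 h8 hE.sum_eq hE.sum_mul_self_eq

lemma rootReflection_cremona_zero (i j k : Fin r) (x : Fin (r + 1) → ℤ) :
    rootReflection (lineClass r - excClass i - excClass j - excClass k) x 0 =
      x 0 + (x 0 + x i.succ + x j.succ + x k.succ) := by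
  simp [rootReflection, interZ_sub_left]

lemma hasSeparatingRoot_excClass (h3 : 3 ≤ r) (h8 : r ≤ 8) (i : Fin r) (d : ℕ) :
    ∀ E' : Fin (r + 1) → ℤ, IsMinusOneClass E' → 1 ≤ interZ (excClass i) E' →
      E' 0 = d → HasSeparatingRoot (excClass i) E' := by
  induction d using Nat.strong_induction_on with
  | _ d ih =>
  intro E' hE' hpos hd
  rw [interZ_excClass] at hpos
  have h := (hE'.isCremonaReducible h3 h8).2.2.2
  beta_reduce at h
  obtain ⟨j, hj⟩ | ⟨j, hij, k, hik, hjk, hs⟩ | ⟨j, hij, k, hik, hjk, l, hil, hjl, hkl, hs⟩ :=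
    h i (by omega)
  · have hji : j ≠ i := by rintro rfl; omega
    refine ⟨_, isRootClass_exc_sub_exc hji, ?_, ?_⟩
    · simp [interZ_sub_left, excClass_succ, hji]
    · simp [interZ_sub_left, hj]
  · refine ⟨_, isRootClass_cremona hij hik hjk, ?_, ?_⟩
    · simp [interZ_sub_left, excClass_succ, hij.symm, hik.symm]
    · simp [interZ_sub_left, hs]
  · have hα := isRootClass_cremona hjk hjl hkl
    have hfix : rootReflection (lineClass r - excClass j - excClass k - excClass l)
        (excClass i) = excClass i := by
      simp [rootReflection, interZ_sub_left, excClass_succ, hij.symm, hik.symm, hil.symm]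
    have hR := hE'.rootReflection hα
    have h0 := (hR.isCremonaReducible h3 h8).1
    have hz := rootReflection_cremona_zero j k l E'
    refine .of_rootReflection hα ?_
    have hp := interZ_rootReflection hα (excClass i) E'
    rw [hfix] at hp ⊢
    refine ih _ ?_ _ hR ?_ (Int.toNat_of_nonneg h0).symm
    · omega
    · rw [hp, interZ_excClass]; exact hpos

lemma IsMinusOneClass.hasSeparatingRoot (h3 : 3 ≤ r) (h8 : r ≤ 8) (d : ℕ) :
    ∀ E E' : Fin (r + 1) → ℤ, IsMinusOneClass E → IsMinusOneClass E' → 1 ≤ interZ E E' →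
      E 0 = d → HasSeparatingRoot E E' := by
  induction d using Nat.strong_induction_on with
  | _ d ih =>
  intro E E' hE hE' hpos hd
  obtain ⟨hnn, hzero, hlt, -⟩ := hE.isCremonaReducible h3 h8
  beta_reduce at hzero hlt
  obtain h0 | h0 := hnn.eq_or_lt
  · obtain ⟨i, hi, hi'⟩ := hzero h0.symm
    obtain rfl : E = excClass i := by
      ext j
      refine Fin.cases (by simp [← h0]) (fun j => ?_) j
      rw [excClass_succ]
      split_ifs with hj
      · rw [hj, hi]
      · exact hi' j hj
    exact hasSeparatingRoot_excClass h3 h8 i _ E' hE' hpos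
      (Int.toNat_of_nonneg (hE'.isCremonaReducible h3 h8).1).symm
  · obtain ⟨i, j, hij, k, hik, hjk, hs⟩ := hlt h0
    have hα := isRootClass_cremona hij hik hjk
    have hR := hE.rootReflection hα
    have hR0 := (hR.isCremonaReducible h3 h8).1
    have hz := rootReflection_cremona_zero i j k E
    refine .of_rootReflection hα (ih _ ?_ _ _ hR (hE'.rootReflection hα) ?_
      (Int.toNat_of_nonneg hR0).symm)
    · omega
    · rwa [interZ_rootReflection hα]

end Classes

theorem sum_decomposition_of_positive_pairing (r : ℕ) (h3 : 3 ≤ r) (h8 : r ≤ 8)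
    (E E' : Fin (r + 1) → ℤ) (hE : IsMinusOneClass E) (hE' : IsMinusOneClass E')
    (hpos : 1 ≤ interZ E E') :
    ∃ E₁ E₂ : Fin (r + 1) → ℤ, IsMinusOneClass E₁ ∧ IsMinusOneClass E₂ ∧
      E + E' = E₁ + E₂ ∧ E ≠ E₁ ∧ E ≠ E₂ := by
  exact (IsMinusOneClass.hasSeparatingRoot h3 h8 _ E E' hE hE' hpos
    (Int.toNat_of_nonneg (hE.isCremonaReducible h3 h8).1).symm).exists_decomposition hE hE' hpos
end

section
/- Let r be an integer with 3 ≤ r ≤ 8, let N_r denote the number of (−1)-classes in ℤ^{r+1}, and let α(S_s) := (s+1) · vol{x ∈ Nef_s : 0 ≤ B(−K_s, x) ≤ 1} for s ∈ {r−1, r}, where vol is the standard Lebesgue measure on ℝ^{s+1}. Then α(S_r) = N_r · α(S_{r−1}) / (r · (9−r)). -/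
open scoped BigOperators
open MeasureTheory

/-- Peyre's constant `α(S_n)` via the cone formula:
`(n+1)` times the Lebesgue volume of `{x ∈ Nef_n : 0 ≤ B(-K_n, x) ≤ 1}`. -/
noncomputable def alphaConst (n : ℕ) : ℝ :=
  ((n : ℝ) + 1) * (volume {x : Fin (n + 1) → ℝ | x ∈ NefCone n ∧
    0 ≤ interR (antiKR n) x ∧ interR (antiKR n) x ≤ 1}).toReal

/-- The Lorentzian form `x₀y₀ - x₁y₁ - ⋯ - x_ny_n` over a commutative ring. -/
def lorentz {R : Type*} [CommRing R] {n : ℕ} (x y : Fin (n + 1) → R) : R :=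
  2 * x 0 * y 0 - ∑ i, x i * y i

/-- The vector `(3, -1, …, -1)` over a commutative ring. -/
def kappa (R : Type*) [CommRing R] (n : ℕ) : Fin (n + 1) → R := fun i => if i = 0 then 3 else -1

/-- Coordinatewise inclusion of integral vectors in real vectors. -/
def toReal {n : ℕ} (E : Fin (n + 1) → ℤ) : Fin (n + 1) → ℝ := fun i => (E i : ℝ)

/-- The reflection `x ↦ x + B(a, x) a` in a vector `a` of square `-2`. -/
def reflect {R : Type*} [CommRing R] {n : ℕ} (a x : Fin (n + 1) → R) : Fin (n + 1) → R :=
  x + lorentz a x • a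

/-- A root: an integral vector of square `-2` orthogonal to the anticanonical class. -/
def IsRootVector {n : ℕ} (a : Fin (n + 1) → ℤ) : Prop :=
  lorentz a a = -2 ∧ lorentz (kappa ℤ n) a = 0

section Form

variable {R : Type*} [CommRing R] {n : ℕ}

lemma lorentz_eq (x y : Fin (n + 1) → R) :
    lorentz x y = x 0 * y 0 - ∑ i : Fin n, x i.succ * y i.succ := by
  rw [lorentz, Fin.sum_univ_succ]; ring

lemma lorentz_comm (x y : Fin (n + 1) → R) : lorentz x y = lorentz y x := by
  simp only [lorentz_eq, mul_comm]

lemma lorentz_add_right (x y z : Fin (n + 1) → R) :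
    lorentz x (y + z) = lorentz x y + lorentz x z := by
  simp only [lorentz_eq, Pi.add_apply, mul_add, Finset.sum_add_distrib]; ring

lemma lorentz_smul_right (c : R) (x y : Fin (n + 1) → R) :
    lorentz x (c • y) = c * lorentz x y := by
  simp only [lorentz_eq, Pi.smul_apply, smul_eq_mul, mul_sub, Finset.mul_sum]
  congr 1
  · ring
  · exact Finset.sum_congr rfl fun i _ => by ring

lemma lorentz_sub_right (x y z : Fin (n + 1) → R) :
    lorentz x (y - z) = lorentz x y - lorentz x z := by
  simp only [lorentz_eq, Pi.sub_apply, mul_sub, Finset.sum_sub_distrib]; ring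

lemma lorentz_add_left (x y z : Fin (n + 1) → R) :
    lorentz (x + y) z = lorentz x z + lorentz y z := by
  rw [lorentz_comm, lorentz_add_right, lorentz_comm z x, lorentz_comm z y]

lemma lorentz_sub_left (x y z : Fin (n + 1) → R) :
    lorentz (x - y) z = lorentz x z - lorentz y z := by
  rw [lorentz_comm, lorentz_sub_right, lorentz_comm z x, lorentz_comm z y]

lemma lorentz_smul_left (c : R) (x y : Fin (n + 1) → R) :
    lorentz (c • x) y = c * lorentz x y := by
  rw [lorentz_comm, lorentz_smul_right, lorentz_comm]

lemma lorentz_single_zero (x : Fin (n + 1) → R) : lorentz (Pi.single 0 1) x = x 0 := by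
  simp [lorentz_eq]

lemma lorentz_single {i : Fin (n + 1)} (hi : i ≠ 0) (x : Fin (n + 1) → R) :
    lorentz (Pi.single i 1) x = - x i := by
  simp [lorentz, Pi.single_apply, hi.symm]

lemma kappa_zero : kappa R n 0 = 3 := rfl

lemma kappa_of_ne {i : Fin (n + 1)} (hi : i ≠ 0) : kappa R n i = -1 := if_neg hi

lemma lorentz_kappa (x : Fin (n + 1) → R) :
    lorentz (kappa R n) x = 3 * x 0 + ∑ i : Fin n, x i.succ := by
  simp [lorentz_eq, kappa, Fin.succ_ne_zero]

lemma lorentz_kappa_self : lorentz (kappa R n) (kappa R n) = 9 - n := by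
  simp [lorentz_kappa, kappa, Fin.succ_ne_zero]; ring

lemma lorentz_snoc (x y : Fin (n + 1) → R) (a b : R) :
    lorentz (n := n + 1) (Fin.snoc x a : Fin (n + 1 + 1) → R) (Fin.snoc y b : Fin (n + 1 + 1) → R)
      = lorentz x y - a * b := by
  have h : ∀ (z : Fin (n + 1) → R) (c : R), (Fin.snoc z c : Fin (n + 1 + 1) → R) 0 = z 0 :=
    fun z c => Fin.snoc_castSucc (α := fun _ => R) c z 0
  rw [lorentz, Fin.sum_univ_castSucc, lorentz, h, h]
  simp only [Fin.snoc_castSucc, Fin.snoc_last]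
  ring

lemma kappa_succ : kappa R (n + 1) = (Fin.snoc (kappa R n) (-1) : Fin (n + 1 + 1) → R) := by
  funext i
  refine Fin.lastCases ?_ (fun j => ?_) i
  · rw [Fin.snoc_last]; exact kappa_of_ne (Fin.last_pos.ne')
  · rw [Fin.snoc_castSucc]; simp [kappa]

lemma single_last : (Pi.single (Fin.last (n + 1)) 1 : Fin (n + 1 + 1) → R) =
    (Fin.snoc (0 : Fin (n + 1) → R) 1 : Fin (n + 1 + 1) → R) := by
  funext i
  refine Fin.lastCases ?_ (fun j => ?_) i
  · simp
  · simp

lemma lorentz_reflect (a x y : Fin (n + 1) → R) (ha : lorentz a a = -2) :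
    lorentz (reflect a x) (reflect a y) = lorentz x y := by
  simp only [reflect, lorentz_add_left, lorentz_add_right, lorentz_smul_left, lorentz_smul_right,
    ha, lorentz_comm x a]
  ring

lemma reflect_reflect (a x : Fin (n + 1) → R) (ha : lorentz a a = -2) :
    reflect a (reflect a x) = x := by
  funext i
  simp only [reflect, lorentz_add_right, lorentz_smul_right, ha, Pi.add_apply, Pi.smul_apply,
    smul_eq_mul]
  ring

lemma lorentz_reflect_left (a x y : Fin (n + 1) → R) (ha : lorentz a a = -2) :
    lorentz (reflect a x) y = lorentz x (reflect a y) := by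
  rw [← lorentz_reflect a x (reflect a y) ha, reflect_reflect a y ha]

lemma reflect_kappa (a : Fin (n + 1) → R) (ha : lorentz (kappa R n) a = 0) :
    reflect a (kappa R n) = kappa R n := by
  rw [reflect, lorentz_comm, ha, zero_smul, add_zero]

lemma lorentz_kappa_reflect (a x : Fin (n + 1) → R) (ha : lorentz a a = -2)
    (hk : lorentz (kappa R n) a = 0) :
    lorentz (kappa R n) (reflect a x) = lorentz (kappa R n) x := by
  rw [← lorentz_reflect_left a _ _ ha, reflect_kappa a hk]

end Form

section Classes

variable {n : ℕ}

lemma isMinusOneClass_iff_s9 {E : Fin (n + 1) → ℤ} :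
    IsMinusOneClass E ↔ lorentz E E = -1 ∧ lorentz (kappa ℤ n) E = 1 := Iff.rfl

lemma mem_nefCone_iff {x : Fin (n + 1) → ℝ} :
    x ∈ NefCone n ↔ ∀ E : Fin (n + 1) → ℤ, IsMinusOneClass E → 0 ≤ lorentz (toReal E) x := Iff.rfl

lemma lorentz_toReal (E F : Fin (n + 1) → ℤ) :
    lorentz (toReal E) (toReal F) = ((lorentz E F : ℤ) : ℝ) := by
  simp [lorentz, toReal]

lemma toReal_kappa : toReal (kappa ℤ n) = kappa ℝ n := by
  funext i; simp only [toReal, kappa]; split_ifs <;> simp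

lemma toReal_reflect (a E : Fin (n + 1) → ℤ) :
    toReal (reflect a E) = reflect (toReal a) (toReal E) := by
  funext i
  simp only [reflect, lorentz_toReal, Pi.add_apply, Pi.smul_apply, smul_eq_mul]
  simp [toReal]

lemma toReal_single (i : Fin (n + 1)) : toReal (Pi.single i 1) = Pi.single i 1 := by
  funext j; simp [toReal, Pi.single_apply]

lemma toReal_injective : Function.Injective (toReal : (Fin (n + 1) → ℤ) → Fin (n + 1) → ℝ) :=
  fun _ _ h => funext fun i => Int.cast_injective (congrFun h i)

lemma IsMinusOneClass.lorentz_kappa_toReal {E : Fin (n + 1) → ℤ} (hE : IsMinusOneClass E) :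
    lorentz (toReal E) (kappa ℝ n) = 1 := by
  rw [← toReal_kappa, lorentz_toReal, lorentz_comm, (isMinusOneClass_iff_s9.1 hE).2, Int.cast_one]

lemma IsRootVector.toReal_self {a : Fin (n + 1) → ℤ} (ha : IsRootVector a) :
    lorentz (toReal a) (toReal a) = -2 := by
  rw [lorentz_toReal, ha.1]; norm_num

lemma IsRootVector.toReal_kappa {a : Fin (n + 1) → ℤ} (ha : IsRootVector a) :
    lorentz (kappa ℝ n) (toReal a) = 0 := by
  rw [← _root_.toReal_kappa, lorentz_toReal, ha.2]; norm_num

lemma IsMinusOneClass.map_reflect {a E : Fin (n + 1) → ℤ} (hE : IsMinusOneClass E)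
    (ha : IsRootVector a) : IsMinusOneClass (reflect a E) := by
  rw [isMinusOneClass_iff_s9] at hE ⊢
  rw [lorentz_reflect a _ _ ha.1, lorentz_kappa_reflect a _ ha.1 ha.2]
  exact hE

lemma isMinusOneClass_single {i : Fin (n + 1)} (hi : i ≠ 0) :
    IsMinusOneClass (Pi.single i 1 : Fin (n + 1) → ℤ) := by
  rw [isMinusOneClass_iff_s9, lorentz_comm (kappa ℤ n), lorentz_single hi, lorentz_single hi,
    kappa_of_ne hi]
  simp

lemma isMinusOneClass_line {i j : Fin (n + 1)} (hi : i ≠ 0) (hj : j ≠ 0) (hij : i ≠ j) :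
    IsMinusOneClass (Pi.single 0 1 - Pi.single i 1 - Pi.single j 1 : Fin (n + 1) → ℤ) := by
  rw [isMinusOneClass_iff_s9, lorentz_comm (kappa ℤ n)]
  simp only [lorentz_sub_left, lorentz_single_zero, lorentz_single hi, lorentz_single hj,
    kappa_of_ne hi, kappa_of_ne hj, kappa_zero, Pi.sub_apply]
  simp [hi, hj, hij, hij.symm, hi.symm, hj.symm]

lemma isRootVector_sub {i j : Fin (n + 1)} (hi : i ≠ 0) (hj : j ≠ 0) (hij : i ≠ j) :
    IsRootVector (Pi.single i 1 - Pi.single j 1 : Fin (n + 1) → ℤ) := by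
  rw [IsRootVector, lorentz_comm (kappa ℤ n)]
  simp only [lorentz_sub_left, lorentz_single hi, lorentz_single hj,
    kappa_of_ne hi, kappa_of_ne hj, Pi.sub_apply]
  simp [hij, hij.symm]

lemma isRootVector_cremona {i j k : Fin (n + 1)} (hi : i ≠ 0) (hj : j ≠ 0) (hk : k ≠ 0)
    (hij : i ≠ j) (hik : i ≠ k) (hjk : j ≠ k) :
    IsRootVector
      (Pi.single 0 1 - Pi.single i 1 - Pi.single j 1 - Pi.single k 1 : Fin (n + 1) → ℤ) := by
  rw [IsRootVector, lorentz_comm (kappa ℤ n)]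
  simp only [lorentz_sub_left, lorentz_single_zero, lorentz_single hi, lorentz_single hj,
    lorentz_single hk, kappa_of_ne hi, kappa_of_ne hj, kappa_of_ne hk, kappa_zero, Pi.sub_apply]
  simp [hi, hj, hk, hij, hij.symm, hik, hik.symm, hjk, hjk.symm, hi.symm, hj.symm, hk.symm]

lemma sum_succ_sq_le (hn : n ≤ 8) (v : Fin (n + 1) → ℤ) :
    (∑ i : Fin n, v i.succ) ^ 2 ≤ 8 * ∑ i : Fin n, v i.succ ^ 2 := by
  have h := sq_sum_le_card_mul_sum_sq (s := (Finset.univ : Finset (Fin n)))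
    (f := fun i => v i.succ)
  have h0 : 0 ≤ ∑ i : Fin n, v i.succ ^ 2 := Finset.sum_nonneg fun i _ => sq_nonneg _
  have hn' : (n : ℤ) ≤ 8 := by exact_mod_cast hn
  simp only [Finset.card_univ, Fintype.card_fin] at h
  nlinarith

/-- The orthogonal complement of the anticanonical class is negative definite for `n ≤ 8`. -/
lemma lorentz_self_nonpos (hn : n ≤ 8) {v : Fin (n + 1) → ℤ} (hv : lorentz (kappa ℤ n) v = 0) :
    lorentz v v ≤ 0 ∧ (lorentz v v = 0 → v = 0) := by
  have h1 := sum_succ_sq_le hn v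
  rw [lorentz_kappa] at hv
  have h2 : ∑ i : Fin n, v i.succ = -3 * v 0 := by linarith
  rw [h2] at h1
  have h3 : lorentz v v = v 0 ^ 2 - ∑ i : Fin n, v i.succ ^ 2 := by
    rw [lorentz_eq]; simp only [sq]
  rw [h3]
  refine ⟨by nlinarith [sq_nonneg (v 0)], fun h => ?_⟩
  have h4 : v 0 = 0 := by
    have : v 0 ^ 2 ≤ 0 := by linarith
    exact pow_eq_zero_iff two_ne_zero |>.1 (le_antisymm this (sq_nonneg _))
  have h5 : ∑ i : Fin n, v i.succ ^ 2 = 0 := by rw [h4] at h; linarith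
  rw [Finset.sum_eq_zero_iff_of_nonneg fun i _ => sq_nonneg _] at h5
  funext i
  refine Fin.cases h4 (fun j => ?_) i
  exact pow_eq_zero_iff two_ne_zero |>.1 (h5 j (Finset.mem_univ _))

lemma IsMinusOneClass.neg_one_le_lorentz (hn : n ≤ 8) {E F : Fin (n + 1) → ℤ}
    (hE : IsMinusOneClass E) (hF : IsMinusOneClass F) :
    -1 ≤ lorentz E F ∧ (lorentz E F = -1 → E = F) := by
  rw [isMinusOneClass_iff_s9] at hE hF
  have h := lorentz_self_nonpos hn (v := E - F) (by rw [lorentz_sub_right, hE.2, hF.2, sub_self])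
  have h1 : lorentz (E - F) (E - F) = -2 - 2 * lorentz E F := by
    rw [lorentz_sub_right, lorentz_sub_left, lorentz_sub_left, hE.1, hF.1, lorentz_comm F E]; ring
  rw [h1] at h
  exact ⟨by linarith [h.1], fun h' => sub_eq_zero.1 (h.2 (by rw [h']; ring))⟩

lemma finite_minusOneClasses (hn : n ≤ 8) : {E : Fin (n + 1) → ℤ | IsMinusOneClass E}.Finite := by
  refine (Set.finite_Icc (fun _ => -8 : Fin (n + 1) → ℤ) (fun _ => 8)).subset fun E hE => ?_
  obtain ⟨h1, h2⟩ := isMinusOneClass_iff_s9.1 hE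
  have h3 := sum_succ_sq_le hn E
  rw [lorentz_kappa] at h2
  rw [lorentz_eq] at h1
  simp only [← sq] at h1
  have h4 : ∑ i : Fin n, E i.succ = 1 - 3 * E 0 := by linarith
  have h5 : ∑ i : Fin n, E i.succ ^ 2 = E 0 ^ 2 + 1 := by linarith
  rw [h4, h5] at h3
  have h6 : -1 ≤ E 0 := by nlinarith
  have h7 : E 0 ≤ 7 := by nlinarith
  have h8 : ∀ i, -8 ≤ E i ∧ E i ≤ 8 := by
    intro i
    refine Fin.cases ⟨by linarith, by linarith⟩ (fun j => ?_) i
    have h9 : E j.succ ^ 2 ≤ ∑ i : Fin n, E i.succ ^ 2 :=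
      Finset.single_le_sum (f := fun i : Fin n => E i.succ ^ 2) (fun i _ => sq_nonneg _)
        (Finset.mem_univ j)
    exact abs_le.1 (abs_le_of_sq_le_sq (by nlinarith) (by norm_num))
  exact ⟨fun i => (h8 i).1, fun i => (h8 i).2⟩

/-- Every exceptional multiplicity of a `(-1)`-class other than an exceptional class is
nonnegative. -/
lemma IsMinusOneClass.apply_nonpos (hn : n ≤ 8) {E : Fin (n + 1) → ℤ} (hE : IsMinusOneClass E)
    {i : Fin (n + 1)} (hi : i ≠ 0) (hne : E ≠ Pi.single i 1) : E i ≤ 0 := by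
  have h := (isMinusOneClass_single hi).neg_one_le_lorentz hn hE
  rw [lorentz_single hi] at h
  by_contra! hpos
  exact hne (h.2 (by linarith [h.1])).symm

/-- Noether's inequality for `(-1)`-classes: three multiplicities add up to more than the
degree. -/
lemma IsMinusOneClass.exists_noether (h3 : 3 ≤ n) {E : Fin (n + 1) → ℤ}
    (hE : IsMinusOneClass E) (hneg : ∀ i, i ≠ 0 → E i ≤ 0) :
    ∃ i j k : Fin (n + 1), i ≠ 0 ∧ j ≠ 0 ∧ k ≠ 0 ∧ i ≠ j ∧ i ≠ k ∧ j ≠ k ∧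
      E 0 + E i + E j + E k < 0 := by
  obtain ⟨h1, h2⟩ := isMinusOneClass_iff_s9.1 hE
  rw [lorentz_kappa] at h2
  rw [lorentz_eq] at h1
  have key : ∀ s : Finset (Fin n), s.card < 3 → ∃ k, k ∉ s ∧ ∀ l, l ∉ s → E k.succ ≤ E l.succ := by
    intro s hs
    have hne : (sᶜ).Nonempty := by
      rw [← Finset.card_pos, Finset.card_compl, Fintype.card_fin]; omega
    obtain ⟨k, hk, hmin⟩ := Finset.exists_min_image sᶜ (fun l => E l.succ) hne
    exact ⟨k, Finset.mem_compl.1 hk, fun l hl => hmin l (Finset.mem_compl.2 hl)⟩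
  obtain ⟨i, -, hi⟩ := key ∅ (by simp)
  obtain ⟨j, hj, hj'⟩ := key {i} (by simp)
  obtain ⟨k, hk, hk'⟩ := key {i, j} (Finset.card_le_two.trans_lt (by norm_num))
  simp only [Finset.mem_singleton, Finset.mem_insert, not_or, Finset.notMem_empty,
    not_false_eq_true, forall_const] at hi hj hj' hk hk'
  refine ⟨i.succ, j.succ, k.succ, Fin.succ_ne_zero _, Fin.succ_ne_zero _, Fin.succ_ne_zero _,
    fun h => hj (Fin.succ_injective _ h.symm), fun h => hk.1 (Fin.succ_injective _ h.symm),
    fun h => hk.2 (Fin.succ_injective _ h.symm), ?_⟩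
  have hsum : ∑ l : Fin n, E l.succ * (E l.succ - E k.succ) ≤
      E i.succ * (E i.succ - E k.succ) + E j.succ * (E j.succ - E k.succ) := by
    rw [← Finset.sum_pair (f := fun l : Fin n => E l.succ * (E l.succ - E k.succ)) (Ne.symm hj),
      ← Finset.sum_add_sum_compl {i, j}]
    have : ∑ l ∈ ({i, j} : Finset (Fin n))ᶜ, E l.succ * (E l.succ - E k.succ) ≤ 0 := by
      refine Finset.sum_nonpos fun l hl => ?_
      rw [Finset.mem_compl, Finset.mem_insert, Finset.mem_singleton, not_or] at hl
      exact mul_nonpos_of_nonpos_of_nonneg (hneg _ (Fin.succ_ne_zero _))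
        (sub_nonneg.2 (hk' l hl))
    linarith
  have hexp : ∑ l : Fin n, E l.succ * (E l.succ - E k.succ) =
      E 0 ^ 2 + 1 - E k.succ * (1 - 3 * E 0) := by
    simp only [mul_sub, Finset.sum_sub_distrib, ← Finset.sum_mul]
    have : ∑ l : Fin n, E l.succ = 1 - 3 * E 0 := by linarith
    rw [this]; linarith
  rw [hexp] at hsum
  have hik := hi k
  have hjk := hj' k hk.1
  have hk0 := hneg _ (Fin.succ_ne_zero k)
  by_contra! hcon
  generalize E i.succ = x at *
  generalize E j.succ = y at *
  generalize E k.succ = z at *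
  generalize E 0 = d at *
  obtain ⟨a, rfl⟩ : ∃ a, x = z - a := ⟨z - x, by ring⟩
  obtain ⟨b, rfl⟩ : ∃ b, y = z - b := ⟨z - y, by ring⟩
  obtain ⟨e, rfl⟩ : ∃ e, d = e - 3 * z + a + b := ⟨d + 3 * z - a - b, by ring⟩
  obtain ⟨w, rfl⟩ : ∃ w, z = - w := ⟨-z, by ring⟩
  have ha : 0 ≤ a := by linarith
  have hb : 0 ≤ b := by linarith
  have he : 0 ≤ e := by linarith
  have hw : 0 ≤ w := by linarith
  nlinarith [mul_nonneg ha hb, mul_nonneg ha he, mul_nonneg hb he, mul_nonneg hw ha,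
    mul_nonneg hw hb, mul_nonneg hw he, sq_nonneg e]

/-- Every `(-1)`-class is obtained from the last exceptional class by reflections in roots. -/
lemma IsMinusOneClass.reflect_induction (h3 : 3 ≤ n) (h8 : n ≤ 8)
    {p : (Fin (n + 1) → ℤ) → Prop} (last : p (Pi.single (Fin.last n) 1))
    (step : ∀ a E, IsRootVector a → IsMinusOneClass E → p (reflect a E) → p E) :
    ∀ {E : Fin (n + 1) → ℤ}, IsMinusOneClass E → p E := by
  have hl : Fin.last n ≠ 0 := fun h => by
    have := congrArg Fin.val h
    simp only [Fin.val_last, Fin.val_zero] at this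
    omega
  have hsingle : ∀ i : Fin (n + 1), i ≠ 0 → p (Pi.single i 1) := by
    intro i hi
    rcases eq_or_ne i (Fin.last n) with rfl | hne
    · exact last
    · refine step (Pi.single i 1 - Pi.single (Fin.last n) 1) _ (isRootVector_sub hi hl hne)
        (isMinusOneClass_single hi) ?_
      convert last using 1
      rw [reflect, lorentz_sub_left, lorentz_single hi, lorentz_single hl]
      simp [hne.symm]
  have main : ∀ (d : ℕ) (E : Fin (n + 1) → ℤ), IsMinusOneClass E → E 0 ≤ d → p E := by
    intro d
    induction d with
    | zero =>
      intro E hE h0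
      by_cases hex : ∃ i, i ≠ 0 ∧ E = Pi.single i 1
      · obtain ⟨i, hi, rfl⟩ := hex
        exact hsingle i hi
      · push Not at hex
        have hneg := fun i hi => hE.apply_nonpos h8 (i := i) hi (hex i hi)
        have h2 := (isMinusOneClass_iff_s9.1 hE).2
        rw [lorentz_kappa] at h2
        have := Finset.sum_nonpos (s := Finset.univ) (f := fun i : Fin n => E i.succ)
          fun i _ => hneg _ (Fin.succ_ne_zero i)
        push_cast at h0
        linarith
    | succ d ih =>
      intro E hE hd
      by_cases hex : ∃ i, i ≠ 0 ∧ E = Pi.single i 1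
      · obtain ⟨i, hi, rfl⟩ := hex
        exact hsingle i hi
      · push Not at hex
        have hneg := fun i hi => hE.apply_nonpos h8 (i := i) hi (hex i hi)
        obtain ⟨i, j, k, hi, hj, hk, hij, hik, hjk, hlt⟩ := hE.exists_noether h3 hneg
        have ha := isRootVector_cremona hi hj hk hij hik hjk
        refine step _ E ha hE (ih _ (hE.map_reflect ha) ?_)
        simp only [reflect, lorentz_sub_left, lorentz_single_zero, lorentz_single hi,
          lorentz_single hj, lorentz_single hk, Pi.add_apply, Pi.smul_apply, Pi.sub_apply,
          Pi.single_eq_same, Pi.single_eq_of_ne hi.symm, Pi.single_eq_of_ne hj.symm,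
          Pi.single_eq_of_ne hk.symm, smul_eq_mul]
        push_cast at hd
        linarith
  intro E hE
  exact main (E 0).toNat E hE (Int.self_le_toNat _)

end Classes

section Nef

variable {n : ℕ}

/-- Two vectors of the closed forward light cone pair nonnegatively. -/
lemma lorentz_nonneg_of_cone {x y : Fin (n + 1) → ℝ} (hx0 : 0 ≤ x 0) (hx : 0 ≤ lorentz x x)
    (hy0 : 0 ≤ y 0) (hy : 0 ≤ lorentz y y) : 0 ≤ lorentz x y := by
  rw [lorentz_eq] at *
  simp only [← sq] at hx hy
  have h := Finset.sum_mul_sq_le_sq_mul_sq Finset.univ (fun i : Fin n => x i.succ)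
    (fun i => y i.succ)
  have h1 : (∑ i : Fin n, x i.succ ^ 2) * ∑ i : Fin n, y i.succ ^ 2 ≤ x 0 ^ 2 * y 0 ^ 2 :=
    mul_le_mul (by linarith) (by linarith) (Finset.sum_nonneg fun i _ => sq_nonneg _)
      (sq_nonneg _)
  have h2 := abs_le_of_sq_le_sq (h.trans (h1.trans_eq (mul_pow _ _ 2).symm))
    (mul_nonneg hx0 hy0)
  linarith [(abs_le.1 h2).2]

lemma lorentz_kappa_nonneg_of_cone (hn : n ≤ 9) {x : Fin (n + 1) → ℝ} (hx0 : 0 ≤ x 0)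
    (hx : 0 ≤ lorentz x x) : 0 ≤ lorentz (kappa ℝ n) x := by
  refine lorentz_nonneg_of_cone (by rw [kappa_zero]; norm_num) ?_ hx0 hx
  have : (n : ℝ) ≤ 9 := by exact_mod_cast hn
  rw [lorentz_kappa_self]
  linarith

lemma apply_nonpos_of_mem_nefCone {y : Fin (n + 1) → ℝ} (hy : y ∈ NefCone n) {i : Fin (n + 1)}
    (hi : i ≠ 0) : y i ≤ 0 := by
  have h := mem_nefCone_iff.1 hy _ (isMinusOneClass_single hi)
  rw [toReal_single, lorentz_single hi] at h
  linarith

lemma line_nonneg_of_mem_nefCone {y : Fin (n + 1) → ℝ} (hy : y ∈ NefCone n) {i j : Fin (n + 1)}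
    (hi : i ≠ 0) (hj : j ≠ 0) (hij : i ≠ j) : 0 ≤ y 0 + y i + y j := by
  have h := mem_nefCone_iff.1 hy _ (isMinusOneClass_line hi hj hij)
  have h1 : toReal (Pi.single 0 1 - Pi.single i 1 - Pi.single j 1 : Fin (n + 1) → ℤ) =
      Pi.single 0 1 - Pi.single i 1 - Pi.single j 1 := by
    simp only [← toReal_single]
    funext k
    simp [toReal]
  rw [h1, lorentz_sub_left, lorentz_sub_left, lorentz_single_zero, lorentz_single hi,
    lorentz_single hj] at h
  linarith

lemma zero_apply_nonneg_of_mem_nefCone (hn : 2 ≤ n) {y : Fin (n + 1) → ℝ} (hy : y ∈ NefCone n) :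
    0 ≤ y 0 := by
  have h1 : (⟨1, by omega⟩ : Fin (n + 1)) ≠ 0 := by simp [Fin.ext_iff]
  have h2 : (⟨2, by omega⟩ : Fin (n + 1)) ≠ 0 := by simp [Fin.ext_iff]
  linarith [line_nonneg_of_mem_nefCone hy h1 h2 (by simp [Fin.ext_iff]),
    apply_nonpos_of_mem_nefCone hy h1, apply_nonpos_of_mem_nefCone hy h2]

lemma reflect_mem_nefCone {a : Fin (n + 1) → ℤ} (ha : IsRootVector a) {x : Fin (n + 1) → ℝ}
    (hx : x ∈ NefCone n) : reflect (toReal a) x ∈ NefCone n := by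
  rw [mem_nefCone_iff] at hx ⊢
  intro E hE
  rw [← lorentz_reflect_left _ _ _ ha.toReal_self, ← toReal_reflect]
  exact hx _ (hE.map_reflect ha)

lemma toReal_snoc (E : Fin (n + 1) → ℤ) (k : ℤ) :
    toReal (n := n + 1) (Fin.snoc E k : Fin (n + 1 + 1) → ℤ) =
      (Fin.snoc (toReal E) (k : ℝ) : Fin (n + 1 + 1) → ℝ) := by
  funext i
  refine Fin.lastCases ?_ (fun j => ?_) i <;> simp [toReal]

lemma isMinusOneClass_snoc {E : Fin (n + 1) → ℤ} {k : ℤ} :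
    IsMinusOneClass (n := n + 1) (Fin.snoc E k : Fin (n + 1 + 1) → ℤ) ↔
      lorentz E E = k ^ 2 - 1 ∧ lorentz (kappa ℤ n) E = 1 - k := by
  rw [isMinusOneClass_iff_s9, kappa_succ, lorentz_snoc, lorentz_snoc]
  constructor <;> rintro ⟨h1, h2⟩ <;> constructor <;> linarith

lemma mem_nefCone_of_snoc_zero {y : Fin (n + 1) → ℝ}
    (hy : (Fin.snoc y 0 : Fin (n + 1 + 1) → ℝ) ∈ NefCone (n + 1)) : y ∈ NefCone n := by
  intro E hE
  have h := mem_nefCone_iff.1 hy (Fin.snoc E 0 : Fin (n + 1 + 1) → ℤ)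
    (isMinusOneClass_snoc.2 (by simpa [isMinusOneClass_iff_s9] using hE))
  rw [toReal_snoc, lorentz_snoc, mul_zero, sub_zero] at h
  exact h

lemma exists_minimal_class (h1 : 1 ≤ n) (h8 : n ≤ 8) (x : Fin (n + 1) → ℝ) :
    ∃ E : Fin (n + 1) → ℤ, IsMinusOneClass E ∧ ∀ F : Fin (n + 1) → ℤ, IsMinusOneClass F →
      lorentz (toReal E) x ≤ lorentz (toReal F) x := by
  have hne : (⟨1, by omega⟩ : Fin (n + 1)) ≠ 0 := by simp [Fin.ext_iff]
  exact Set.exists_min_image _ (fun E => lorentz (toReal E) x) (finite_minusOneClasses h8)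
    ⟨_, isMinusOneClass_single hne⟩

/-- Nef classes have nonnegative square. -/
lemma lorentz_self_nonneg_of_mem_nefCone (h2 : 2 ≤ n) (h8 : n ≤ 8) :
    ∀ {y : Fin (n + 1) → ℝ}, y ∈ NefCone n → 0 ≤ lorentz y y := by
  induction n, h2 using Nat.le_induction with
  | base =>
    intro y hy
    have h1 := apply_nonpos_of_mem_nefCone hy (i := 1) (by decide)
    have h2 := apply_nonpos_of_mem_nefCone hy (i := 2) (by decide)
    have h3 := line_nonneg_of_mem_nefCone hy (i := 1) (j := 2) (by decide) (by decide) (by decide)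
    have h4 : lorentz y y = y 0 * y 0 - (y 1 * y 1 + y 2 * y 2) := by
      rw [lorentz_eq, Fin.sum_univ_two]; rfl
    rw [h4]
    nlinarith
  | succ n h2 ih =>
    have facet : ∀ E : Fin (n + 1 + 1) → ℤ, IsMinusOneClass E → ∀ z ∈ NefCone (n + 1),
        lorentz (toReal E) z = 0 → 0 ≤ lorentz z z := by
      intro E hE
      refine hE.reflect_induction (by omega) h8 (p := fun E => ∀ z ∈ NefCone (n + 1),
        lorentz (toReal E) z = 0 → 0 ≤ lorentz z z) ?_ ?_
      · intro z hz h0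
        rw [toReal_single, lorentz_single (Fin.last_pos.ne'), neg_eq_zero] at h0
        have hz' : z = (Fin.snoc (Fin.init z) 0 : Fin (n + 1 + 1) → ℝ) := by
          rw [← h0, Fin.snoc_init_self]
        rw [hz'] at hz ⊢
        rw [lorentz_snoc, mul_zero, sub_zero]
        exact ih (by omega) (mem_nefCone_of_snoc_zero hz)
      · intro a E ha hE h z hz h0
        rw [← lorentz_reflect (toReal a) z z ha.toReal_self]
        refine h _ (reflect_mem_nefCone ha hz) ?_
        rw [toReal_reflect, lorentz_reflect _ _ _ ha.toReal_self, h0]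
    intro y hy
    obtain ⟨E, hE, hmin⟩ := exists_minimal_class (by omega) h8 y
    set m := lorentz (toReal E) y with hm
    have hm0 : 0 ≤ m := mem_nefCone_iff.1 hy E hE
    have hz : y - m • kappa ℝ (n + 1) ∈ NefCone (n + 1) := by
      intro F hF
      change 0 ≤ lorentz (toReal F) _
      rw [lorentz_sub_right, lorentz_smul_right, hF.lorentz_kappa_toReal]
      linarith [hmin F hF]
    have hzz := facet E hE _ hz (by
      rw [lorentz_sub_right, lorentz_smul_right, hE.lorentz_kappa_toReal, ← hm]; ring)
    have hkz := lorentz_kappa_nonneg_of_cone (by omega)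
      (zero_apply_nonneg_of_mem_nefCone (by omega) hz) hzz
    have hy' : y = (y - m • kappa ℝ (n + 1)) + m • kappa ℝ (n + 1) := by abel
    generalize y - m • kappa ℝ (n + 1) = z at *
    rw [hy']
    simp only [lorentz_add_left, lorentz_add_right, lorentz_smul_left, lorentz_smul_right,
      lorentz_kappa_self, lorentz_comm z (kappa ℝ (n + 1))]
    have h9 : (0 : ℝ) ≤ 9 - ((n + 1 : ℕ) : ℝ) := by
      have : ((n + 1 : ℕ) : ℝ) ≤ 8 := by exact_mod_cast h8
      linarith
    have := mul_nonneg hm0 hkz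
    have := mul_nonneg hm0 (mul_nonneg hm0 h9)
    linarith

lemma lorentz_kappa_nonneg_of_mem_nefCone (h2 : 2 ≤ n) (h8 : n ≤ 8) {y : Fin (n + 1) → ℝ}
    (hy : y ∈ NefCone n) : 0 ≤ lorentz (kappa ℝ n) y :=
  lorentz_kappa_nonneg_of_cone (by omega) (zero_apply_nonneg_of_mem_nefCone h2 hy)
    (lorentz_self_nonneg_of_mem_nefCone h2 h8 hy)

/-- The pullback of a nef class to one more blow-up is nef. -/
lemma snoc_zero_mem_nefCone (h2 : 2 ≤ n) (h7 : n ≤ 7) {y : Fin (n + 1) → ℝ}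
    (hy : y ∈ NefCone n) : (Fin.snoc y 0 : Fin (n + 1 + 1) → ℝ) ∈ NefCone (n + 1) := by
  rw [mem_nefCone_iff]
  intro F hF
  obtain ⟨D, k, rfl⟩ : ∃ (D : Fin (n + 1) → ℤ) (k : ℤ), F = Fin.snoc (α := fun _ => ℤ) D k :=
    ⟨Fin.init F, F (Fin.last _), (Fin.snoc_init_self F).symm⟩
  rw [toReal_snoc, lorentz_snoc, mul_zero, sub_zero]
  by_cases hlast : (Fin.snoc D k : Fin (n + 1 + 1) → ℤ) = Pi.single (Fin.last (n + 1)) 1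
  · rw [single_last, Fin.snoc_inj] at hlast
    rw [hlast.1]
    simp [lorentz, toReal]
  have hk : k ≤ 0 := by
    have := hF.apply_nonpos (by omega) Fin.last_pos.ne' hlast
    rwa [Fin.snoc_last] at this
  obtain ⟨hD, hκ⟩ := isMinusOneClass_snoc.1 hF
  rcases hk.eq_or_lt with rfl | hk
  · exact mem_nefCone_iff.1 hy D
      (isMinusOneClass_iff_s9.2 ⟨by simpa using hD, by simpa using hκ⟩)
  have hDD : 0 ≤ lorentz (toReal D) (toReal D) := by
    rw [lorentz_toReal, hD]
    have : 0 ≤ k ^ 2 - 1 := by nlinarith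
    exact_mod_cast this
  refine lorentz_nonneg_of_cone ?_ hDD (zero_apply_nonneg_of_mem_nefCone h2 hy)
    (lorentz_self_nonneg_of_mem_nefCone h2 (by omega) hy)
  by_contra! hneg
  have h := lorentz_kappa_nonneg_of_cone (x := (-1 : ℝ) • toReal D) (n := n) (by omega)
    (by simpa using hneg.le) (by rw [lorentz_smul_left, lorentz_smul_right]; simpa using hDD)
  rw [lorentz_smul_right, ← toReal_kappa, lorentz_toReal, hκ] at h
  push_cast at h
  have : (k : ℝ) < 0 := by exact_mod_cast hk
  linarith

end Nef

section Volume

variable {n : ℕ}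

/-- The part of the nef cone where the anticanonical degree is at most `u`. -/
def nefBelow (n : ℕ) (u : ℝ) : Set (Fin (n + 1) → ℝ) :=
  {x | x ∈ NefCone n ∧ 0 ≤ lorentz (kappa ℝ n) x ∧ lorentz (kappa ℝ n) x ≤ u}

/-- The part of the truncated nef cone where `E` has the smallest pairing among all
`(-1)`-classes. -/
def minRegion (E : Fin (n + 1) → ℤ) : Set (Fin (n + 1) → ℝ) :=
  {x | x ∈ nefBelow n 1 ∧ ∀ F : Fin (n + 1) → ℤ, IsMinusOneClass F →
    lorentz (toReal E) x ≤ lorentz (toReal F) x}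

lemma alphaConst_eq (n : ℕ) : alphaConst n = ((n : ℝ) + 1) * (volume (nefBelow n 1)).toReal := rfl

lemma continuous_lorentz (a : Fin (n + 1) → ℝ) : Continuous fun x => lorentz a x := by
  unfold lorentz
  fun_prop

lemma isClosed_nefBelow (u : ℝ) : IsClosed (nefBelow n u) := by
  have h : IsClosed {x : Fin (n + 1) → ℝ |
      ∀ E : Fin (n + 1) → ℤ, IsMinusOneClass E → 0 ≤ lorentz (toReal E) x} := by
    simp only [Set.ofPred_forall]
    exact isClosed_iInter fun E => isClosed_iInter fun _ =>
      isClosed_le continuous_const (continuous_lorentz _)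
  exact h.inter ((isClosed_le continuous_const (continuous_lorentz _)).inter
    (isClosed_le (continuous_lorentz _) continuous_const))

lemma isClosed_minRegion (E : Fin (n + 1) → ℤ) : IsClosed (minRegion E) := by
  have h : IsClosed {x : Fin (n + 1) → ℝ | ∀ F : Fin (n + 1) → ℤ, IsMinusOneClass F →
      lorentz (toReal E) x ≤ lorentz (toReal F) x} := by
    simp only [Set.ofPred_forall]
    exact isClosed_iInter fun F => isClosed_iInter fun _ =>
      isClosed_le (continuous_lorentz _) (continuous_lorentz _)
  exact (isClosed_nefBelow 1).inter h

/-- Pairing with a fixed vector as a linear form. -/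
def lorentzForm (a : Fin (n + 1) → ℝ) : (Fin (n + 1) → ℝ) →ₗ[ℝ] ℝ where
  toFun x := lorentz a x
  map_add' := lorentz_add_right a
  map_smul' c x := lorentz_smul_right c a x

lemma volume_lorentz_eq_zero {a : Fin (n + 1) → ℝ} (ha : a ≠ 0) :
    volume {x : Fin (n + 1) → ℝ | lorentz a x = 0} = 0 := by
  refine Measure.addHaar_submodule volume (LinearMap.ker (lorentzForm a)) fun htop => ha ?_
  have h : ∀ x, lorentz x a = 0 := fun x => by
    rw [lorentz_comm]
    exact LinearMap.mem_ker.1 (htop ▸ Submodule.mem_top : x ∈ LinearMap.ker (lorentzForm a))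
  funext i
  rcases eq_or_ne i 0 with rfl | hi
  · simpa [lorentz_single_zero] using h (Pi.single 0 1)
  · simpa [lorentz_single hi] using h (Pi.single i 1)

lemma volume_preimage_reflect {a : Fin (n + 1) → ℝ} (ha : lorentz a a = -2)
    (s : Set (Fin (n + 1) → ℝ)) : volume (reflect a ⁻¹' s) = volume s := by
  let f : (Fin (n + 1) → ℝ) →ₗ[ℝ] (Fin (n + 1) → ℝ) :=
    LinearMap.id + (lorentzForm a).smulRight a
  have hf : ⇑f = reflect a := rfl
  have hff : f ∘ₗ f = LinearMap.id := LinearMap.ext fun x => reflect_reflect a x ha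
  have hdet : LinearMap.det f * LinearMap.det f = 1 := by
    rw [← LinearMap.det_comp, hff, LinearMap.det_id]
  have habs : |LinearMap.det f| = 1 := by
    rcases mul_self_eq_one_iff.1 hdet with h | h <;> simp [h]
  rw [← hf, Measure.addHaar_preimage_linearMap volume (fun h => by simp [h] at hdet), abs_inv,
    habs, inv_one, ENNReal.ofReal_one, one_mul]

lemma reflect_mem_minRegion {a E : Fin (n + 1) → ℤ} (ha : IsRootVector a) {x : Fin (n + 1) → ℝ}
    (hx : x ∈ minRegion E) : reflect (toReal a) x ∈ minRegion (reflect a E) := by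
  obtain ⟨⟨h1, h2, h3⟩, h4⟩ := hx
  refine ⟨⟨reflect_mem_nefCone ha h1, ?_, ?_⟩, fun F hF => ?_⟩
  · rwa [lorentz_kappa_reflect _ _ ha.toReal_self ha.toReal_kappa]
  · rwa [lorentz_kappa_reflect _ _ ha.toReal_self ha.toReal_kappa]
  · rw [toReal_reflect, lorentz_reflect _ _ _ ha.toReal_self,
      ← lorentz_reflect_left _ _ _ ha.toReal_self, ← toReal_reflect]
    exact h4 _ (hF.map_reflect ha)

lemma volume_minRegion_reflect {a E : Fin (n + 1) → ℤ} (ha : IsRootVector a) :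
    volume (minRegion (reflect a E)) = volume (minRegion E) := by
  rw [← volume_preimage_reflect ha.toReal_self (minRegion (reflect a E))]
  congr 1
  ext x
  refine ⟨fun hx => ?_, reflect_mem_minRegion ha⟩
  have := reflect_mem_minRegion ha (Set.mem_preimage.1 hx)
  rwa [reflect_reflect _ _ ha.1, reflect_reflect _ _ ha.toReal_self] at this

lemma volume_nefBelow_eq_sum (h3 : 3 ≤ n) (h8 : n ≤ 8) :
    volume (nefBelow n 1) = ({E : Fin (n + 1) → ℤ | IsMinusOneClass E}.ncard : ENNReal) *
      volume (minRegion (Pi.single (Fin.last n) 1 : Fin (n + 1) → ℤ)) := by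
  have hfin := finite_minusOneClasses h8
  have hunion : nefBelow n 1 = ⋃ E ∈ hfin.toFinset, minRegion E := by
    ext x
    simp only [Set.mem_iUnion, Set.Finite.mem_toFinset, Set.mem_ofPred_eq, exists_prop]
    constructor
    · intro hx
      obtain ⟨E, hE, hmin⟩ := exists_minimal_class (by omega) h8 x
      exact ⟨E, hE, hx, hmin⟩
    · rintro ⟨E, -, hx⟩
      exact hx.1
  have heq : ∀ E ∈ hfin.toFinset, volume (minRegion E) =
      volume (minRegion (Pi.single (Fin.last n) 1 : Fin (n + 1) → ℤ)) := by
    intro E hE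
    rw [Set.Finite.mem_toFinset] at hE
    refine IsMinusOneClass.reflect_induction h3 h8 (p := fun E => volume (minRegion E) =
      volume (minRegion (Pi.single (Fin.last n) 1 : Fin (n + 1) → ℤ))) rfl ?_ hE
    intro a E ha _ h
    rw [← h, volume_minRegion_reflect ha]
  rw [hunion, measure_biUnion_finset₀, Finset.sum_congr rfl heq, Finset.sum_const, nsmul_eq_mul,
    Set.ncard_eq_toFinset_card _ hfin]
  · intro E hE F hF hne
    refine measure_mono_null ?_ (volume_lorentz_eq_zero
      (sub_ne_zero.2 (toReal_injective.ne hne) : toReal E - toReal F ≠ 0))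
    rintro x ⟨hxE, hxF⟩
    rw [Finset.mem_coe, Set.Finite.mem_toFinset] at hE hF
    rw [Set.mem_ofPred_eq, lorentz_sub_left]
    linarith [hxE.2 F hF, hxF.2 E hE]
  · exact fun E _ => (isClosed_minRegion E).measurableSet.nullMeasurableSet

lemma volume_nefBelow {u : ℝ} (hu : 0 < u) :
    volume (nefBelow n u) = ENNReal.ofReal (u ^ (n + 1)) * volume (nefBelow n 1) := by
  have h : nefBelow n u = (u⁻¹ • ·) ⁻¹' nefBelow n 1 := by
    ext x
    have hu' : 0 < u⁻¹ := inv_pos.2 hu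
    simp only [nefBelow, Set.mem_preimage, Set.mem_ofPred_eq, mem_nefCone_iff, lorentz_smul_right,
      mul_nonneg_iff_of_pos_left hu', inv_mul_le_iff₀ hu, mul_one]
  rw [h, Measure.addHaar_preimage_smul _ (inv_ne_zero hu.ne')]
  simp [abs_of_pos hu]

lemma snoc_mem_minRegion_iff (h2 : 2 ≤ n) (h7 : n ≤ 7) (z : Fin (n + 1) → ℝ) (t : ℝ) :
    (Fin.snoc z t : Fin (n + 1 + 1) → ℝ) ∈
        minRegion (Pi.single (Fin.last (n + 1)) 1 : Fin (n + 1 + 1) → ℤ) ↔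
      t ≤ 0 ∧ z + t • kappa ℝ n ∈ nefBelow n (1 + (8 - n) * t) := by
  have hne : Fin.last (n + 1) ≠ 0 := Fin.last_pos.ne'
  have hsplit : (Fin.snoc z t : Fin (n + 1 + 1) → ℝ) =
      (Fin.snoc (z + t • kappa ℝ n) 0 : Fin (n + 1 + 1) → ℝ) - t • kappa ℝ (n + 1) := by
    funext i
    rw [kappa_succ]
    refine Fin.lastCases ?_ (fun j => ?_) i <;> simp
  have hE : lorentz (toReal (Pi.single (Fin.last (n + 1)) 1 : Fin (n + 1 + 1) → ℤ))
      (Fin.snoc z t : Fin (n + 1 + 1) → ℝ) = -t := by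
    rw [toReal_single, lorentz_single hne, Fin.snoc_last]
  have hF : ∀ F : Fin (n + 1 + 1) → ℤ, IsMinusOneClass F →
      lorentz (toReal F) (Fin.snoc z t : Fin (n + 1 + 1) → ℝ) =
        lorentz (toReal F) (Fin.snoc (z + t • kappa ℝ n) 0 : Fin (n + 1 + 1) → ℝ) - t := by
    intro F hF
    rw [hsplit, lorentz_sub_right, lorentz_smul_right, hF.lorentz_kappa_toReal, mul_one]
  have hκ : lorentz (kappa ℝ (n + 1)) (Fin.snoc z t : Fin (n + 1 + 1) → ℝ) =
      lorentz (kappa ℝ n) (z + t • kappa ℝ n) - (8 - n) * t := by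
    rw [hsplit, lorentz_sub_right, lorentz_smul_right, lorentz_kappa_self, kappa_succ,
      lorentz_snoc]
    push_cast
    ring
  simp only [minRegion, Set.mem_ofPred_eq, hE]
  constructor
  · rintro ⟨⟨hnef, -, hle⟩, hmin⟩
    have ht : 0 ≤ -t := hE ▸ mem_nefCone_iff.1 hnef _ (isMinusOneClass_single hne)
    have hy : z + t • kappa ℝ n ∈ NefCone n := by
      refine mem_nefCone_of_snoc_zero (mem_nefCone_iff.2 fun F hF' => ?_)
      linarith [hmin F hF', hF F hF']
    exact ⟨by linarith, hy, lorentz_kappa_nonneg_of_mem_nefCone h2 (by omega) hy, by linarith⟩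
  · rintro ⟨ht, hy, h0, hle⟩
    have hy' := mem_nefCone_iff.1 (snoc_zero_mem_nefCone h2 h7 hy)
    have hn : (n : ℝ) ≤ 7 := by exact_mod_cast h7
    refine ⟨⟨mem_nefCone_iff.2 fun F hF' => ?_, ?_, by linarith⟩, fun F hF' => ?_⟩
    · linarith [hy' F hF', hF F hF']
    · rw [hκ]
      nlinarith
    · linarith [hy' F hF', hF F hF']

lemma lintegral_one_add_mul_pow {c : ℝ} (hc : 0 < c) (k : ℕ) :
    ∫⁻ t in Set.Ioc (-c⁻¹) 0, ENNReal.ofReal ((1 + c * t) ^ k) =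
      ENNReal.ofReal ((c * (k + 1))⁻¹) := by
  have hc' : 0 < c⁻¹ := inv_pos.2 hc
  rw [← ofReal_integral_eq_lintegral_ofReal,
    ← intervalIntegral.integral_of_le (by linarith),
    intervalIntegral.integral_comp_add_mul (fun x => x ^ k) hc.ne', integral_pow]
  · congr 1
    simp [hc.ne']
    ring
  · exact (Continuous.integrableOn_Icc (by fun_prop)).mono_set Set.Ioc_subset_Icc_self
  · refine (ae_restrict_mem measurableSet_Ioc).mono fun t ht => pow_nonneg ?_ _
    have := mul_lt_mul_of_pos_left ht.1 hc
    rw [mul_neg, mul_inv_cancel₀ hc.ne'] at this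
    linarith

lemma volume_minRegion_last (h2 : 2 ≤ n) (h7 : n ≤ 7) :
    volume (minRegion (Pi.single (Fin.last (n + 1)) 1 : Fin (n + 1 + 1) → ℤ)) =
      ENNReal.ofReal (((8 - n) * (n + 2))⁻¹) * volume (nefBelow n 1) := by
  have hc : (0 : ℝ) < 8 - n := by
    have : (n : ℝ) ≤ 7 := by exact_mod_cast h7
    linarith
  set S := minRegion (Pi.single (Fin.last (n + 1)) 1 : Fin (n + 1 + 1) → ℤ) with hS
  have hSm : MeasurableSet S := (isClosed_minRegion _).measurableSet
  have he := (volume_preserving_piFinSuccAbove (fun _ : Fin (n + 1 + 1) => ℝ)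
    (Fin.last (n + 1))).symm
  have hslice : ∀ t, Prod.mk t ⁻¹' ((MeasurableEquiv.piFinSuccAbove
      (fun _ : Fin (n + 1 + 1) => ℝ) (Fin.last (n + 1))).symm ⁻¹' S) =
      {z | t ≤ 0 ∧ z + t • kappa ℝ n ∈ nefBelow n (1 + (8 - n) * t)} := by
    intro t
    ext z
    rw [Set.mem_ofPred_eq, ← snoc_mem_minRegion_iff h2 h7]
    simp only [Set.mem_preimage]
    rw [← Fin.insertNth_last' (β := ℝ)]
    rfl
  rw [← he.measure_preimage_equiv, Measure.volume_eq_prod, Measure.prod_apply (he.measurable hSm)]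
  simp only [hslice]
  have hae : (fun t : ℝ => volume {z : Fin (n + 1) → ℝ | t ≤ 0 ∧
      z + t • kappa ℝ n ∈ nefBelow n (1 + (8 - n) * t)}) =ᵐ[volume]
      (Set.Ioc (-(8 - n : ℝ)⁻¹) 0).indicator fun t =>
        ENNReal.ofReal ((1 + (8 - n) * t) ^ (n + 1)) * volume (nefBelow n 1) := by
    filter_upwards [Measure.ae_ne volume (-(8 - n : ℝ)⁻¹)] with t ht
    by_cases ht0 : t ≤ 0
    · simp only [ht0, true_and]
      change volume ((· + t • kappa ℝ n) ⁻¹' nefBelow n (1 + (8 - n) * t)) = _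
      rw [measure_preimage_add_right]
      by_cases ht1 : -(8 - n : ℝ)⁻¹ < t
      · rw [Set.indicator_of_mem (Set.mem_Ioc.2 ⟨ht1, ht0⟩), volume_nefBelow]
        have := mul_lt_mul_of_pos_left ht1 hc
        rw [mul_neg, mul_inv_cancel₀ hc.ne'] at this
        linarith
      · rw [Set.indicator_of_notMem fun h => ht1 h.1]
        have hlt : t < -(8 - n : ℝ)⁻¹ := lt_of_le_of_ne (not_lt.1 ht1) ht
        have := mul_lt_mul_of_pos_left hlt hc
        rw [mul_neg, mul_inv_cancel₀ hc.ne'] at this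
        have hempty : nefBelow n (1 + (8 - n) * t) = ∅ :=
          Set.eq_empty_of_forall_notMem fun x hx => by linarith [hx.2.1, hx.2.2]
        rw [hempty, measure_empty]
    · rw [Set.indicator_of_notMem fun h => ht0 h.2]
      simp [ht0]
  rw [lintegral_congr_ae hae, lintegral_indicator measurableSet_Ioc,
    lintegral_mul_const _ (by fun_prop), lintegral_one_add_mul_pow hc]
  push_cast
  ring_nf

end Volume

theorem alpha_recursion (s : ℕ) (h3 : 3 ≤ s + 1) (h8 : s + 1 ≤ 8) :
    alphaConst (s + 1) =
      (({E : Fin (s + 1 + 1) → ℤ | IsMinusOneClass E}.ncard : ℝ) * alphaConst s) /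
        (((s : ℝ) + 1) * (9 - ((s : ℝ) + 1))) := by
  have hc : (0 : ℝ) < 8 - s := by
    have : (s : ℝ) + 1 ≤ 8 := by exact_mod_cast h8
    linarith
  rw [alphaConst_eq, alphaConst_eq, volume_nefBelow_eq_sum h3 h8,
    volume_minRegion_last (by omega) (by omega), ENNReal.toReal_mul, ENNReal.toReal_mul,
    ENNReal.toReal_natCast, ENNReal.toReal_ofReal (by positivity)]
  have h9 : (9 : ℝ) - (s + 1) = 8 - s := by ring
  rw [h9]
  have hs : (s : ℝ) + 1 ≠ 0 := by positivity
  have hs2 : (s : ℝ) + 2 ≠ 0 := by positivity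
  push_cast
  field_simp
  ring
end

section
/- For the blow-up S_4 of ℙ² in 4 points in general position, Peyre's constant is α(S_4) = 1/144; that is, 5 · vol{x ∈ ℝ⁵ : B(E, x) ≥ 0 for every (−1)-class E, and 0 ≤ B(−K_4, x) ≤ 1} = 1/144, where vol is the standard Lebesgue measure on ℝ⁵. -/
open scoped BigOperators
open MeasureTheory

open Equiv in
/-- Reindexing the coordinates of `ι → ℝ` by a permutation preserves Lebesgue measure. -/
lemma volume_preimage_comp_perm {ι : Type*} [Fintype ι] (ρ : Perm ι) (A : Set (ι → ℝ)) :
    volume ((fun x : ι → ℝ => x ∘ ρ) ⁻¹' A) = volume A := by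
  have h := (volume_measurePreserving_piCongrLeft (fun _ : ι => ℝ) ρ.symm).measure_preimage_equiv A
  rw [← h]
  congr 2
  funext x
  ext i
  obtain ⟨j, rfl⟩ := ρ.symm.surjective i
  rw [MeasurableEquiv.piCongrLeft_apply_apply]
  simp

lemma volume_setOf_apply_eq_apply {ι : Type*} [Fintype ι] {i j : ι} (hij : i ≠ j) :
    volume {x : ι → ℝ | x i = x j} = 0 := by
  classical
  have h := Measure.addHaar_submodule (volume : Measure (ι → ℝ))
    (LinearMap.ker ((LinearMap.proj i : (ι → ℝ) →ₗ[ℝ] ℝ) - LinearMap.proj j)) (by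
      intro h
      have h1 : (Pi.single i 1 : ι → ℝ) ∈
          LinearMap.ker ((LinearMap.proj i : (ι → ℝ) →ₗ[ℝ] ℝ) - LinearMap.proj j) :=
        h ▸ Submodule.mem_top
      simp [hij.symm] at h1)
  rw [← h]
  congr 1
  ext x
  simp [sub_eq_zero]

lemma isClosed_setOf_monotone_comp {ι : Type*} {n : ℕ} (e : Fin n → ι) :
    IsClosed {x : ι → ℝ | Monotone (x ∘ e)} := by
  simp only [Monotone, Set.ofPred_forall]
  refine isClosed_iInter fun i => isClosed_iInter fun j => isClosed_iInter fun _ => ?_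
  exact isClosed_le (continuous_apply _) (continuous_apply _)

open Equiv in
/-- If a set is invariant under the permutations of `n` of the coordinates, then its volume is `n!`
times the volume of the part on which these coordinates are sorted. -/
lemma volume_eq_factorial_mul_volume_monotone {ι : Type*} [Fintype ι] {n : ℕ} {e : Fin n → ι}
    (he : Function.Injective e) {A : Set (ι → ℝ)} (hA : MeasurableSet A)
    (h : ∀ σ : Perm (Fin n), ∃ ρ : Perm ι, (∀ i, ρ (e i) = e (σ i)) ∧
      ∀ x : ι → ℝ, x ∘ ρ ∈ A ↔ x ∈ A) :
    volume A = n.factorial * volume (A ∩ {x | Monotone (x ∘ e)}) := by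
  have hunion : A = ⋃ σ : Perm (Fin n), A ∩ {x | Monotone (x ∘ e ∘ σ)} := by
    rw [← Set.inter_iUnion, eq_comm, Set.inter_eq_left]
    exact fun x _ => Set.mem_iUnion.2 ⟨_, Tuple.monotone_sort (x ∘ e)⟩
  have hvol (σ : Perm (Fin n)) : volume (A ∩ {x | Monotone (x ∘ e ∘ σ)}) =
      volume (A ∩ {x | Monotone (x ∘ e)}) := by
    obtain ⟨ρ, hρ, hinv⟩ := h σ
    rw [← volume_preimage_comp_perm ρ (A ∩ {x | Monotone (x ∘ e)})]
    congr 1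
    ext x
    have hcomp : (x ∘ ρ) ∘ e = x ∘ e ∘ σ := by
      funext i
      simp [hρ]
    simp only [Set.mem_inter_iff, Set.mem_preimage, Set.mem_ofPred_eq, hinv, hcomp]
  have hnull : volume {x : ι → ℝ | ¬ Function.Injective (x ∘ e)} = 0 := by
    refine measure_mono_null (t := ⋃ p : {p : Fin n × Fin n // p.1 ≠ p.2},
      {x : ι → ℝ | x (e p.1.1) = x (e p.1.2)}) ?_
      (measure_iUnion_null fun p => volume_setOf_apply_eq_apply (he.ne p.2))
    intro x hx
    simp only [Function.Injective, Set.mem_ofPred_eq, not_forall] at hx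
    obtain ⟨i, j, hij, hne⟩ := hx
    exact Set.mem_iUnion.2 ⟨⟨(i, j), hne⟩, hij⟩
  conv_lhs => rw [hunion]
  rw [measure_iUnion₀]
  · simp [hvol, Fintype.card_perm]
  · intro σ τ hστ
    refine measure_mono_null ?_ hnull
    rintro x ⟨⟨-, hσ⟩, -, hτ⟩ hinj
    refine hστ (Equiv.ext fun i => hinj ?_)
    exact congrFun (Tuple.unique_monotone (f := x ∘ e) hσ hτ) i
  · intro σ
    exact (hA.inter (isClosed_setOf_monotone_comp _).measurableSet).nullMeasurableSet

/-- The volume of the simplex of sorted vectors in the unit cube. -/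
lemma volume_Icc_inter_monotone (n : ℕ) :
    volume (Set.Icc (0 : Fin n → ℝ) 1 ∩ {x | Monotone x}) = (n.factorial : ENNReal)⁻¹ := by
  have h := volume_eq_factorial_mul_volume_monotone (e := (id : Fin n → Fin n))
    Function.injective_id (A := Set.Icc (0 : Fin n → ℝ) 1) measurableSet_Icc fun σ =>
      ⟨σ, fun _ => rfl, fun x => by
        simp only [Set.mem_Icc, Pi.le_def, Function.comp_apply, Pi.zero_apply, Pi.one_apply]
        rw [σ.forall_congr_right (q := fun i => 0 ≤ x i),
          σ.forall_congr_right (q := fun i => x i ≤ 1)]⟩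
  rw [Real.volume_Icc_pi] at h
  simp only [Pi.one_apply, Pi.zero_apply, sub_zero, ENNReal.ofReal_one, Finset.prod_const_one,
    Function.comp_id] at h
  exact ENNReal.eq_inv_of_mul_eq_one_left (by rw [mul_comm]; exact h.symm)

lemma interR_antiKR_four (x : Fin (4 + 1) → ℝ) :
    interR (antiKR 4) x = 3 * x 0 + ∑ i : Fin 4, x i.succ := by
  simp only [interR, antiKR, Fin.sum_univ_succ, Fin.succ_ne_zero, if_true, if_false]
  ring

/-- The nef cone of `S₄` is cut out by the classes `Eᵢ` and `H - Eᵢ - Eⱼ`. -/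
lemma mem_nefCone_four_iff (x : Fin (4 + 1) → ℝ) :
    x ∈ NefCone 4 ↔ (∀ i : Fin 4, x i.succ ≤ 0) ∧
      ∀ i j : Fin 4, i ≠ j → 0 ≤ x 0 + x i.succ + x j.succ := by
  constructor
  · intro h
    constructor
    · intro i
      have hE := h (Pi.single i.succ 1) (by unfold IsMinusOneClass; revert i; decide)
      simpa [interR, Pi.single_apply] using hE
    · intro i j hij
      have hE := h (Pi.single 0 1 - Pi.single i.succ 1 - Pi.single j.succ 1)
        (by unfold IsMinusOneClass; revert i j; decide)
      simp only [interR, Pi.sub_apply, Pi.single_apply, Int.cast_sub, Int.cast_ite, Int.cast_one,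
        Int.cast_zero, sub_mul, ite_mul, one_mul, zero_mul, Finset.sum_sub_distrib,
        Finset.sum_ite_eq', Finset.mem_univ, if_true,
        (Fin.succ_ne_zero _).symm, if_false] at hE
      linarith
  · rintro ⟨h1, h2⟩ E ⟨hE1, hE2⟩
    simp only [interZ, antiK, Fin.sum_univ_succ, Fin.succ_ne_zero, if_true, if_false] at hE1 hE2
    simp [Fin.forall_fin_succ] at hE1 hE2 h1 h2
    simp [interR, Fin.sum_univ_succ]
    generalize E 0 = d, E 1 = a, E 2 = b, E 3 = c, E 4 = e at *
    have hsum : a + b + c + e = 1 - 3 * d := by linarith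
    have hsq : a ^ 2 + b ^ 2 + c ^ 2 + e ^ 2 = d ^ 2 + 1 := by linarith
    have hcs : (a + b + c + e) ^ 2 ≤ 4 * (a ^ 2 + b ^ 2 + c ^ 2 + e ^ 2) := by
      linarith [sq_nonneg (a - b), sq_nonneg (a - c), sq_nonneg (a - e), sq_nonneg (b - c),
        sq_nonneg (b - e), sq_nonneg (c - e)]
    rw [hsum, hsq] at hcs
    have hd0 : 0 ≤ d := by nlinarith
    have hd1 : d ≤ 1 := by nlinarith
    have hbound {z : ℤ} (hz : z ^ 2 ≤ 2) : -1 ≤ z ∧ z ≤ 1 := by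
      constructor <;> nlinarith
    obtain ⟨ha, ha'⟩ := hbound (z := a) (by nlinarith)
    obtain ⟨hb, hb'⟩ := hbound (z := b) (by nlinarith)
    obtain ⟨hc, hc'⟩ := hbound (z := c) (by nlinarith)
    obtain ⟨he, he'⟩ := hbound (z := e) (by nlinarith)
    clear hE1 hE2 hcs hbound
    obtain rfl : e = 1 - 3 * d - a - b - c := by linarith
    interval_cases d <;> interval_cases a <;> interval_cases b <;> interval_cases c <;>
      first
      | omega
      | (push_cast; linarith)

/-- The part of the truncated nef cone of `S₄` on which the last four coordinates are sorted is the
preimage of the simplex of sorted vectors in the unit cube under this matrix. -/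
def nefChamberMatrix : Matrix (Fin 5) (Fin 5) ℝ :=
  !![3, 3, 3, 0, 0; 3, 1, 5, 0, 0; 3, 1, 1, 4, 0; 3, 1, 1, 1, 3; 3, 1, 1, 1, 1]

lemma det_nefChamberMatrix : nefChamberMatrix.det = 144 := by
  simp [nefChamberMatrix, Matrix.det_succ_row_zero, Fin.sum_univ_succ, Fin.succAbove]
  norm_num

lemma truncated_nefCone_four_inter_monotone :
    {x : Fin (4 + 1) → ℝ | x ∈ NefCone 4 ∧ 0 ≤ interR (antiKR 4) x ∧ interR (antiKR 4) x ≤ 1} ∩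
        {x | Monotone (x ∘ Fin.succ)} =
      Matrix.toLin' nefChamberMatrix ⁻¹' (Set.Icc (0 : Fin 5 → ℝ) 1 ∩ {x | Monotone x}) := by
  ext x
  simp only [Set.mem_inter_iff, Set.mem_ofPred_eq, mem_nefCone_four_iff, interR_antiKR_four,
    Set.mem_preimage, Fin.monotone_iff_le_succ, Set.mem_Icc, Pi.le_def, Matrix.toLin'_apply]
  simp [nefChamberMatrix, Fin.forall_fin_succ, Matrix.mulVec, dotProduct, Fin.sum_univ_succ]
  constructor <;>
  · intro h
    casesm* _ ∧ _
    and_intros <;> linarith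

lemma isClosed_truncated_nefCone_four :
    IsClosed {x : Fin (4 + 1) → ℝ |
      x ∈ NefCone 4 ∧ 0 ≤ interR (antiKR 4) x ∧ interR (antiKR 4) x ≤ 1} := by
  simp only [mem_nefCone_four_iff, interR_antiKR_four, Set.ofPred_and, Set.ofPred_forall]
  refine .inter (.inter ?_ ?_) (.inter ?_ ?_)
  · exact isClosed_iInter fun i => isClosed_le (by fun_prop) (by fun_prop)
  · exact isClosed_iInter fun i => isClosed_iInter fun j => isClosed_iInter fun _ =>
      isClosed_le (by fun_prop) (by fun_prop)
  · exact isClosed_le (by fun_prop) (by fun_prop)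
  · exact isClosed_le (by fun_prop) (by fun_prop)

lemma truncated_nefCone_four_comp_perm (σ : Equiv.Perm (Fin 4)) :
    ∃ ρ : Equiv.Perm (Fin (4 + 1)), (∀ i, ρ (Fin.succ i) = Fin.succ (σ i)) ∧
      ∀ x : Fin (4 + 1) → ℝ,
        x ∘ ρ ∈ {x : Fin (4 + 1) → ℝ |
          x ∈ NefCone 4 ∧ 0 ≤ interR (antiKR 4) x ∧ interR (antiKR 4) x ≤ 1} ↔
        x ∈ {x : Fin (4 + 1) → ℝ |
          x ∈ NefCone 4 ∧ 0 ≤ interR (antiKR 4) x ∧ interR (antiKR 4) x ≤ 1} := by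
  refine ⟨Equiv.Perm.decomposeFin.symm (0, σ), fun i => by simp, fun x => ?_⟩
  simp only [mem_nefCone_four_iff, interR_antiKR_four, Set.mem_ofPred_eq, Function.comp_apply,
    Equiv.Perm.decomposeFin_symm_apply_succ, Equiv.Perm.decomposeFin_symm_apply_zero,
    Equiv.swap_self, Equiv.refl_apply]
  rw [Equiv.sum_comp σ fun i => x i.succ, ← σ.forall_congr_right (q := fun i => x i.succ ≤ 0),
    ← σ.forall_congr_right
      (q := fun i => ∀ j, i ≠ j → 0 ≤ x 0 + x i.succ + x j.succ)]
  refine and_congr_left fun _ => and_congr_right fun _ => forall_congr' fun i => ?_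
  rw [← σ.forall_congr_right (q := fun j => σ i ≠ j → 0 ≤ x 0 + x (σ i).succ + x j.succ)]
  simp

theorem alpha_S4 :
    5 * (volume {x : Fin (4 + 1) → ℝ | x ∈ NefCone 4 ∧
      0 ≤ interR (antiKR 4) x ∧ interR (antiKR 4) x ≤ 1}).toReal = 1 / 144 := by
  rw [volume_eq_factorial_mul_volume_monotone (Fin.succ_injective 4)
    isClosed_truncated_nefCone_four.measurableSet truncated_nefCone_four_comp_perm,
    truncated_nefCone_four_inter_monotone, Measure.addHaar_preimage_linearMap,
    volume_Icc_inter_monotone, LinearMap.det_toLin', det_nefChamberMatrix]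
  · simp [Nat.factorial]
    norm_num
  · simp [LinearMap.det_toLin', det_nefChamberMatrix]
end

section
/- For the blow-up S_5 of ℙ² in 5 points in general position, Peyre's constant is α(S_5) = 1/180; that is, 6 · vol{x ∈ ℝ⁶ : B(E, x) ≥ 0 for every (−1)-class E, and 0 ≤ B(−K_5, x) ≤ 1} = 1/180, where vol is the standard Lebesgue measure on ℝ⁶. -/
open scoped BigOperators
open MeasureTheory

open Set

/-- The sublevel set `∑ |w i| ≤ t` of the `ℓ¹` norm. -/
def crossPolytope (n : ℕ) (t : ℝ) : Set (Fin n → ℝ) := {w | ∑ i, |w i| ≤ t}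

/-- The polytope cut out by the inequalities `∑ s i * w i ≤ t` for sign vectors `s` of
product `e`. -/
def halfSpinPolytope (n : ℕ) (e : ℤˣ) (t : ℝ) : Set (Fin n → ℝ) :=
  {w | ∀ s : Fin n → ℤˣ, ∏ i, s i = e → ∑ i, ((s i : ℤ) : ℝ) * w i ≤ t}

/-- The points with `∑ |w j| - 2 |w i| ≤ t` at which the `i`-th coordinate is the unique
smallest one in absolute value. -/
def minPiece {n : ℕ} (i : Fin n) (t : ℝ) : Set (Fin n → ℝ) :=
  {w | (∀ j, j ≠ i → |w i| < |w j|) ∧ ∑ j, |w j| - 2 * |w i| ≤ t}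

theorem isClosed_crossPolytope (n : ℕ) (t : ℝ) : IsClosed (crossPolytope n t) :=
  isClosed_le (by fun_prop) (by fun_prop)

theorem isClosed_halfSpinPolytope (n : ℕ) (e : ℤˣ) (t : ℝ) :
    IsClosed (halfSpinPolytope n e t) := by
  simp only [halfSpinPolytope, ofPred_forall]
  exact isClosed_iInter fun s => isClosed_iInter fun _ => isClosed_le (by fun_prop) (by fun_prop)

theorem measurableSet_minPiece {n : ℕ} (i : Fin n) (t : ℝ) : MeasurableSet (minPiece i t) := by
  have hle : IsClosed {w : Fin n → ℝ | ∑ j, |w j| - 2 * |w i| ≤ t} :=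
    isClosed_le (by fun_prop) (by fun_prop)
  refine MeasurableSet.inter (s₁ := {w : Fin n → ℝ | ∀ j, j ≠ i → |w i| < |w j|}) ?_
    hle.measurableSet
  simp only [ofPred_forall]
  exact MeasurableSet.iInter fun j => MeasurableSet.iInter fun _ =>
    (isOpen_lt (by fun_prop) (by fun_prop)).measurableSet

theorem volume_crossPolytope (n : ℕ) [NeZero n] (t : ℝ) :
    volume (crossPolytope n t) =
      ENNReal.ofReal t ^ n * ENNReal.ofReal (2 ^ n / (n.factorial : ℝ)) := by
  have : Nonempty (Fin n) := ⟨0⟩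
  have h := volume_sum_rpow_le (Fin n) le_rfl t
  simpa [crossPolytope, Real.Gamma_nat_eq_factorial, Real.Gamma_two, one_add_one_eq_two] using h

/-! ### Shrinking towards the coordinate hyperplanes -/

/-- Moving a real number of absolute value larger than `m` towards `0` by `m`. -/
noncomputable def shrink (m x : ℝ) : ℝ := if 0 < x then x - m else x + m

theorem abs_shrink {m x : ℝ} (hx : m < |x|) : |shrink m x| = |x| - m := by
  unfold shrink
  split_ifs with h
  · rw [abs_of_pos h] at hx ⊢
    exact abs_of_pos (by linarith)
  · rw [abs_of_nonpos (not_lt.1 h)] at hx ⊢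
    rw [abs_of_nonpos (by linarith)]
    ring

theorem measurePreserving_shrink {m : ℝ} (hm : 0 ≤ m) :
    MeasurePreserving (shrink m) (volume.restrict {x : ℝ | m < |x|}) volume := by
  have hmeas : Measurable (shrink m) :=
    Measurable.ite measurableSet_Ioi (by fun_prop) (by fun_prop)
  refine ⟨hmeas, ?_⟩
  ext s hs
  rw [Measure.map_apply hmeas hs, Measure.restrict_apply (hmeas hs)]
  have h1 : shrink m ⁻¹' s ∩ {x : ℝ | m < |x|} =
      ((fun x => x + -m) ⁻¹' (s ∩ Ioi 0)) ∪ ((fun x => x + m) ⁻¹' (s ∩ Iio 0)) := by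
    ext x
    simp only [shrink, mem_inter_iff, mem_preimage, mem_ofPred_eq, mem_union, mem_Ioi, mem_Iio,
      lt_abs]
    split_ifs with h
    · constructor
      · rintro ⟨h1, h2 | h2⟩
        · exact Or.inl ⟨h1, by linarith⟩
        · linarith
      · rintro (⟨h1, h2⟩ | ⟨h1, h2⟩)
        · exact ⟨h1, Or.inl (by linarith)⟩
        · linarith
    · constructor
      · rintro ⟨h1, h2 | h2⟩
        · linarith
        · exact Or.inr ⟨h1, by linarith⟩
      · rintro (⟨h1, h2⟩ | ⟨h1, h2⟩)
        · linarith
        · exact ⟨h1, Or.inr (by linarith)⟩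
  have h2 : Disjoint ((fun x => x + -m) ⁻¹' (s ∩ Ioi 0)) ((fun x => x + m) ⁻¹' (s ∩ Iio 0)) := by
    rw [Set.disjoint_left]
    rintro x ⟨-, hx⟩ ⟨-, hx'⟩
    simp only [mem_Ioi, mem_Iio] at hx hx'
    linarith
  rw [h1, measure_union h2 ((measurable_id.add_const m) (hs.inter measurableSet_Iio)),
    measure_preimage_add_right, measure_preimage_add_right,
    ← measure_union (by
      rw [Set.disjoint_left]
      rintro x ⟨-, hx⟩ ⟨-, hx'⟩
      exact lt_asymm (mem_Ioi.1 hx) (mem_Iio.1 hx')) (hs.inter measurableSet_Iio), ← inter_union_distrib_left,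
    Ioi_union_Iio]
  exact measure_inter_conull (by simp)

theorem volume_forall_lt_abs_inter {n : ℕ} {m : ℝ} (hm : 0 ≤ m) (c : ℝ) :
    volume {w : Fin n → ℝ | (∀ j, m < |w j|) ∧ ∑ j, |w j| ≤ c} =
      volume (crossPolytope n (c - n * m)) := by
  have hF : MeasurePreserving (fun (w : Fin n → ℝ) j => shrink m (w j))
      (Measure.pi fun _ => volume.restrict {x : ℝ | m < |x|}) (Measure.pi fun _ => volume) :=
    measurePreserving_pi _ _ fun _ => measurePreserving_shrink hm
  rw [← Measure.restrict_pi_pi] at hF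
  have hms := (isClosed_crossPolytope n (c - n * m)).measurableSet
  have h := hF.measure_preimage hms.nullMeasurableSet
  rw [Measure.restrict_apply (hF.measurable hms)] at h
  rw [volume_pi, ← h]
  congr 1
  ext w
  simp only [mem_ofPred_eq, crossPolytope, mem_inter_iff, mem_preimage, mem_univ_pi]
  rw [and_comm]
  refine and_congr_left fun hw => ?_
  rw [Finset.sum_congr rfl fun j _ => abs_shrink (hw j), Finset.sum_sub_distrib]
  simp

/-! ### Slicing along a coordinate -/

theorem volume_eq_lintegral_insertNth {n : ℕ} (i : Fin (n + 1)) {s : Set (Fin (n + 1) → ℝ)}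
    (hs : MeasurableSet s) :
    volume s = ∫⁻ m : ℝ, volume {w : Fin n → ℝ | i.insertNth m w ∈ s} := by
  have he := (volume_preserving_piFinSuccAbove (fun _ : Fin (n + 1) => ℝ) i).symm
  rw [← he.measure_preimage hs.nullMeasurableSet, Measure.volume_eq_prod,
    Measure.prod_apply (he.measurable hs)]
  rfl

theorem volume_crossPolytope_succ (n : ℕ) (t : ℝ) :
    volume (crossPolytope (n + 1) t) = ∫⁻ m : ℝ, volume (crossPolytope n (t - |m|)) := by
  rw [volume_eq_lintegral_insertNth 0 (isClosed_crossPolytope _ _).measurableSet]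
  refine lintegral_congr fun m => ?_
  congr 1
  ext w
  simp [crossPolytope, Fin.sum_univ_succ, le_sub_iff_add_le']

theorem lintegral_comp_mul_left_real {a : ℝ} (ha : a ≠ 0) (f : ℝ → ENNReal) :
    ∫⁻ x, f (a * x) = ENNReal.ofReal |a⁻¹| * ∫⁻ x, f x := by
  rw [← smul_eq_mul, ← lintegral_smul_measure, ← Real.map_volume_mul_left ha]
  exact ((Homeomorph.mulLeft₀ a ha).measurableEmbedding.lintegral_map f).symm

theorem volume_minPiece {n : ℕ} (hn : 2 ≤ n) (i : Fin (n + 1)) (t : ℝ) :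
    volume (minPiece i t) =
      ENNReal.ofReal (n - 1 : ℝ)⁻¹ * volume (crossPolytope (n + 1) t) := by
  have hn' : (0 : ℝ) < n - 1 := by
    have : (2 : ℝ) ≤ n := by exact_mod_cast hn
    linarith
  rw [volume_eq_lintegral_insertNth i (measurableSet_minPiece i t), volume_crossPolytope_succ,
    ← abs_of_pos (inv_pos.2 hn'),
    ← lintegral_comp_mul_left_real hn'.ne' fun m => volume (crossPolytope n (t - |m|))]
  refine lintegral_congr fun m => ?_
  have := volume_forall_lt_abs_inter (n := n) (abs_nonneg m) (t + |m|)
  rw [abs_mul, abs_of_pos hn',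
    show t - ((n : ℝ) - 1) * |m| = t + |m| - n * |m| by ring, ← this]
  congr 1
  ext w
  simp only [minPiece, mem_ofPred_eq, Fin.insertNth_apply_same, Fin.forall_iff_succAbove i,
    Fin.sum_univ_succAbove _ i, Fin.insertNth_apply_succAbove, ne_eq, not_true_eq_false,
    false_implies, true_and, Fin.succAbove_ne, not_false_eq_true, true_implies]
  refine and_congr_right fun _ => ?_
  constructor <;> intro h <;> linarith

/-! ### Volume of the half-spin polytope -/

theorem volume_abs_eq_abs {n : ℕ} {i j : Fin n} (h : i ≠ j) :
    volume {w : Fin n → ℝ | |w i| = |w j|} = 0 := by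
  have key : ∀ c : ℝ, volume
      (LinearMap.ker (LinearMap.proj (R := ℝ) (φ := fun _ : Fin n => ℝ) i - c • LinearMap.proj j) :
        Set (Fin n → ℝ)) = 0 := by
    intro c
    refine Measure.addHaar_submodule _ _ fun htop => ?_
    have : Pi.single i (1 : ℝ) ∈ (⊤ : Submodule ℝ (Fin n → ℝ)) := trivial
    rw [← htop] at this
    simp [h] at this
  refine measure_mono_null ?_ (measure_union_null (key 1) (key (-1)))
  intro w hw
  rcases abs_eq_abs.1 hw with hw | hw
  · left; simp [hw]
  · right; simp [hw]

theorem exists_sign_mul_eq_abs (x : ℝ) : ∃ s : ℤˣ, ((s : ℤ) : ℝ) * x = |x| := by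
  rcases le_total 0 x with h | h
  · exact ⟨1, by simp [abs_of_nonneg h]⟩
  · exact ⟨-1, by simp [abs_of_nonpos h]⟩

theorem unit_mul_le_abs (s : ℤˣ) (x : ℝ) : ((s : ℤ) : ℝ) * x ≤ |x| := by
  rcases Int.units_eq_one_or s with rfl | rfl
  · simpa using le_abs_self x
  · simpa using neg_le_abs x

theorem halfSpinPolytope_inter (n : ℕ) (t : ℝ) :
    halfSpinPolytope n 1 t ∩ halfSpinPolytope n (-1) t = crossPolytope n t := by
  ext w
  constructor
  · rintro ⟨h1, h2⟩
    choose s hs using fun i => exists_sign_mul_eq_abs (w i)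
    change ∑ i, |w i| ≤ t
    simp_rw [← hs]
    rcases Int.units_eq_one_or (∏ i, s i) with h | h
    · exact h1 s h
    · exact h2 s h
  · intro h
    exact ⟨fun s _ => (Finset.sum_le_sum fun i _ => unit_mul_le_abs _ _).trans h,
      fun s _ => (Finset.sum_le_sum fun i _ => unit_mul_le_abs _ _).trans h⟩

theorem sum_update_neg_mul {n : ℕ} {w : Fin n → ℝ} {s : Fin n → ℤˣ}
    (hs : ∀ i, ((s i : ℤ) : ℝ) * w i = |w i|) (i : Fin n) :
    ∑ j, ((Function.update s i (-s i) j : ℤ) : ℝ) * w j = ∑ j, |w j| - 2 * |w i| := by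
  rw [← Finset.add_sum_erase _ _ (Finset.mem_univ i),
    ← Finset.add_sum_erase _ (fun j => |w j|) (Finset.mem_univ i),
    Finset.sum_congr rfl (g := fun j => |w j|)]
  · simp only [Function.update_self, Units.val_neg, Int.cast_neg, neg_mul, hs]
    ring
  · intro j hj
    rw [Function.update_of_ne (Finset.ne_of_mem_erase hj), hs]

theorem prod_update_neg {n : ℕ} (s : Fin n → ℤˣ) (i : Fin n) :
    ∏ j, Function.update s i (-s i) j = -∏ j, s j := by
  rw [← Finset.mul_prod_erase _ _ (Finset.mem_univ i),
    ← Finset.mul_prod_erase _ s (Finset.mem_univ i),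
    Finset.prod_congr rfl (g := s)]
  · simp
  · intro j hj
    rw [Function.update_of_ne (Finset.ne_of_mem_erase hj)]

theorem sum_abs_sub_le_of_mem_halfSpinPolytope {n : ℕ} {e : ℤˣ} {t : ℝ} {w : Fin n → ℝ}
    (hw : w ∈ halfSpinPolytope n e t) (i : Fin n) : ∑ j, |w j| - 2 * |w i| ≤ t := by
  choose s hs using fun i => exists_sign_mul_eq_abs (w i)
  by_cases h : ∏ i, s i = e
  · have := hw s h
    simp_rw [hs] at this
    linarith [abs_nonneg (w i)]
  · rw [← sum_update_neg_mul hs]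
    refine hw _ ?_
    rw [prod_update_neg]
    rcases Int.units_eq_one_or e with rfl | rfl <;>
      rcases Int.units_eq_one_or (∏ i, s i) with h' | h' <;> simp_all

theorem minPiece_subset {n : ℕ} (i : Fin n) (t : ℝ) :
    minPiece i t ⊆ halfSpinPolytope n 1 t ∪ halfSpinPolytope n (-1) t := by
  rintro w ⟨hlt, hle⟩
  have hmin : ∀ j, |w i| ≤ |w j| := fun j => by
    by_cases h : j = i
    · rw [h]
    · exact (hlt j h).le
  choose s hs using fun i => exists_sign_mul_eq_abs (w i)
  have key : ∀ s' : Fin n → ℤˣ, ∏ j, s' j ≠ ∏ j, s j → ∑ j, ((s' j : ℤ) : ℝ) * w j ≤ t := by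
    intro s' hne
    obtain ⟨j, hj⟩ : ∃ j, s' j ≠ s j := by
      by_contra! h
      exact hne (Finset.prod_congr rfl fun j _ => h j)
    have hj' : s' j = Function.update s j (-s j) j := by
      rw [Function.update_self]
      exact (Int.units_ne_iff_eq_neg).1 hj
    have : ∑ k, ((s' k : ℤ) : ℝ) * w k ≤
        ∑ k, ((Function.update s j (-s j) k : ℤ) : ℝ) * w k := by
      refine Finset.sum_le_sum fun k _ => ?_
      by_cases hk : k = j
      · rw [hk, hj']
      · rw [Function.update_of_ne hk, hs]
        exact unit_mul_le_abs _ _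
    rw [sum_update_neg_mul hs] at this
    linarith [hmin j]
  rcases Int.units_eq_one_or (∏ i, s i) with h | h
  · right
    exact fun s' hs' => key s' (by rw [hs', h]; decide)
  · left
    exact fun s' hs' => key s' (by rw [hs', h]; decide)

theorem halfSpinPolytope_union_ae_eq (n : ℕ) [NeZero n] (t : ℝ) :
    (⋃ i, minPiece i t : Set (Fin n → ℝ)) =ᵐ[volume]
      (halfSpinPolytope n 1 t ∪ halfSpinPolytope n (-1) t : Set (Fin n → ℝ)) := by
  refine (LE.le.eventuallyLE (iUnion_subset fun i => minPiece_subset i t)).antisymm ?_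
  have hnull : ∀ᵐ w : Fin n → ℝ, ∀ i j : Fin n, i ≠ j → |w i| ≠ |w j| := by
    refine ae_all_iff.2 fun i => ae_all_iff.2 fun j => ?_
    by_cases h : i = j
    · exact Filter.Eventually.of_forall fun w hne => absurd h hne
    · have := volume_abs_eq_abs h
      rw [ae_iff]
      simpa [h] using this
  filter_upwards [hnull] with w hw hmem
  obtain ⟨i, -, hi⟩ := Finset.exists_min_image (Finset.univ : Finset (Fin n)) (fun j => |w j|)
    ⟨0, Finset.mem_univ _⟩
  refine mem_iUnion.2 ⟨i, fun j hj =>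
    lt_of_le_of_ne (hi j (Finset.mem_univ j)) (hw i j hj.symm), ?_⟩
  rcases hmem with h | h <;> exact sum_abs_sub_le_of_mem_halfSpinPolytope h i

theorem volume_halfSpinPolytope_union {n : ℕ} (hn : 2 ≤ n) (t : ℝ) :
    volume (halfSpinPolytope (n + 1) 1 t ∪ halfSpinPolytope (n + 1) (-1) t) =
      ENNReal.ofReal ((n + 1) / (n - 1) : ℝ) * volume (crossPolytope (n + 1) t) := by
  rw [← measure_congr (halfSpinPolytope_union_ae_eq (n + 1) t), measure_iUnion ?_
    fun i => measurableSet_minPiece i t]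
  · simp only [volume_minPiece hn, tsum_fintype, Finset.sum_const, Finset.card_univ,
      Fintype.card_fin, nsmul_eq_mul]
    rw [div_eq_mul_inv, ENNReal.ofReal_mul (by positivity), mul_assoc]
    congr 1
    rw [← ENNReal.ofReal_natCast]
    push_cast
    rfl
  · intro i j hij
    rw [Function.onFun, Set.disjoint_left]
    rintro w ⟨hi, -⟩ ⟨hj, -⟩
    exact lt_asymm (hi j hij.symm) (hj i hij)

theorem volume_halfSpinPolytope_neg {n : ℕ} (hn : Odd n) (t : ℝ) :
    volume (halfSpinPolytope n (-1) t) = volume (halfSpinPolytope n 1 t) := by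
  rw [← Measure.measure_neg volume (halfSpinPolytope n 1 t)]
  congr 1
  ext w
  have key : ∀ e : ℤˣ, ∀ v : Fin n → ℝ, v ∈ halfSpinPolytope n e t →
      -v ∈ halfSpinPolytope n (-e) t := by
    intro e v hv s hs
    simpa using hv (-s) (by simp [Finset.prod_neg, hn.neg_one_pow, hs])
  rw [Set.mem_neg]
  exact ⟨fun h => by simpa using key _ _ h, fun h => by simpa using key _ _ h⟩

theorem volume_halfSpinPolytope_five {t : ℝ} (ht : 0 ≤ t) :
    volume (halfSpinPolytope 5 1 t) = ENNReal.ofReal (16 / 45 * t ^ 5) := by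
  have h := measure_union_add_inter (μ := volume) (halfSpinPolytope 5 1 t)
    (isClosed_halfSpinPolytope 5 (-1) t).measurableSet
  rw [halfSpinPolytope_inter, volume_halfSpinPolytope_neg (by decide),
    volume_halfSpinPolytope_union (n := 4) (by norm_num), volume_crossPolytope,
    ← ENNReal.ofReal_pow ht, ← ENNReal.ofReal_mul (by positivity),
    ← ENNReal.ofReal_mul (by norm_num), ← ENNReal.ofReal_add (by norm_num; positivity)
      (by positivity), ← two_mul] at h
  have h2 : ENNReal.ofReal (16 / 45 * t ^ 5) * 2 = volume (halfSpinPolytope 5 1 t) * 2 := by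
    rw [mul_comm (volume _), ← h, ← ENNReal.ofReal_ofNat 2, ← ENNReal.ofReal_mul (by positivity)]
    congr 1
    norm_num [Nat.factorial]
    ring
  exact ((ENNReal.mul_left_inj (by norm_num) (by norm_num)).1 h2).symm

/-! ### The nef cone in half-spin coordinates -/

/-- The coordinate change sending `x` to `B(-K, x)` followed by the differences
`B(C, x) - B(-K - C, x)`, for the conic classes `C = H - E_i`. -/
def conicMatrix : Matrix (Fin 6) (Fin 6) ℤ :=
  !![3, 1, 1, 1, 1, 1; -1, 1, -1, -1, -1, -1; -1, -1, 1, -1, -1, -1; -1, -1, -1, 1, -1, -1;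
    -1, -1, -1, -1, 1, -1; -1, -1, -1, -1, -1, 1]

theorem det_conicMatrix : conicMatrix.det = -64 := by decide +kernel

/-- The linear map given by `conicMatrix`. -/
noncomputable def conicMap : (Fin 6 → ℝ) →ₗ[ℝ] (Fin 6 → ℝ) :=
  Matrix.toLin' (conicMatrix.map (Int.castRingHom ℝ))

theorem det_conicMap : LinearMap.det conicMap = -64 := by
  rw [conicMap, LinearMap.det_toLin', ← RingHom.mapMatrix_apply, ← RingHom.map_det,
    det_conicMatrix]
  simp

theorem conicMap_zero (x : Fin 6 → ℝ) : conicMap x 0 = interR (antiKR 5) x := by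
  simp [conicMap, conicMatrix, interR, antiKR, Matrix.toLin'_apply, Matrix.mulVec, dotProduct,
    Fin.sum_univ_succ]
  ring

theorem conicMap_succ (x : Fin 6 → ℝ) (i : Fin 5) :
    conicMap x i.succ = 2 * x i.succ - ∑ j, x j := by
  fin_cases i <;>
  · simp [conicMap, conicMatrix, Matrix.toLin'_apply, Matrix.mulVec, dotProduct,
      Fin.sum_univ_succ]
    ring

/-- The pairing of a class with `x` in half-spin coordinates, for a sign vector `s`. -/
theorem four_mul_interR {E : Fin 6 → ℤ} {s : Fin 5 → ℤˣ} (h0 : 4 * E 0 = 3 + ∑ i, (s i : ℤ))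
    (hs : ∀ i, (s i : ℤ) = 2 * E i.succ + 2 * E 0 - 1) (x : Fin 6 → ℝ) :
    4 * interR (n := 5) (fun i => (E i : ℝ)) x =
      interR (antiKR 5) x - ∑ i, ((s i : ℤ) : ℝ) * conicMap x i.succ := by
  have h0' : 4 * (E 0 : ℝ) = 3 + ∑ i, ((s i : ℤ) : ℝ) := by exact_mod_cast h0
  have hs' : ∀ i, ((s i : ℤ) : ℝ) = 2 * E i.succ + 2 * E 0 - 1 := fun i => by
    exact_mod_cast hs i
  have h := congrArg ((∑ j, x j) * ·) h0'
  simp only [hs'] at h ⊢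
  simp only [conicMap_succ, interR, antiKR, Fin.sum_univ_succ, Finset.univ_eq_empty,
    Finset.sum_empty, if_true, Fin.succ_ne_zero, if_false] at h ⊢
  linear_combination h

theorem exists_signs_of_isMinusOneClass {E : Fin 6 → ℤ} (hE : IsMinusOneClass (n := 5) E) :
    ∃ s : Fin 5 → ℤˣ, ∏ i, s i = 1 ∧ 4 * E 0 = 3 + ∑ i, (s i : ℤ) ∧
      ∀ i, (s i : ℤ) = 2 * E i.succ + 2 * E 0 - 1 := by
  obtain ⟨h1, h2⟩ := hE
  simp only [interZ, antiK, Fin.sum_univ_succ (n := 5), if_true, Fin.succ_ne_zero, if_false,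
    neg_one_mul, Finset.sum_neg_distrib] at h1 h2
  have hsq : ∑ i : Fin 5, (2 * E i.succ + 2 * E 0 - 1) ^ 2 = 5 := by
    have : ∀ i : Fin 5, (2 * E i.succ + 2 * E 0 - 1) ^ 2 =
        4 * (E i.succ * E i.succ) + 4 * (2 * E 0 - 1) * E i.succ + (2 * E 0 - 1) ^ 2 :=
      fun i => by ring
    simp only [this, Finset.sum_add_distrib, ← Finset.mul_sum, Finset.sum_const,
      Finset.card_univ, Fintype.card_fin, nsmul_eq_mul]
    linear_combination (-4) * h1 + 4 * (2 * E 0 - 1) * h2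
  have hpos : ∀ i : Fin 5, 1 ≤ (2 * E i.succ + 2 * E 0 - 1) ^ 2 := fun i => by
    have : 2 * E i.succ + 2 * E 0 - 1 ≠ 0 := by omega
    have := sq_pos_of_ne_zero this
    omega
  have hone : ∀ i : Fin 5, (2 * E i.succ + 2 * E 0 - 1) ^ 2 = 1 := by
    have := (Finset.sum_eq_sum_iff_of_le (s := Finset.univ) fun i _ => hpos i).1
      (by rw [hsq]; simp)
    exact fun i => (this i (Finset.mem_univ i)).symm
  have hunit : ∀ i : Fin 5, ∃ s : ℤˣ, (s : ℤ) = 2 * E i.succ + 2 * E 0 - 1 := fun i =>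
    Int.isUnit_iff.2 (sq_eq_sq_iff_eq_or_eq_neg.1 ((hone i).trans (one_pow 2).symm))
  choose s hs using hunit
  have hsum : 4 * E 0 = 3 + ∑ i, (s i : ℤ) := by
    simp only [hs, Finset.sum_sub_distrib, Finset.sum_add_distrib, ← Finset.mul_sum,
      Finset.sum_const, Finset.card_univ, Fintype.card_fin, nsmul_eq_mul]
    linear_combination -2 * h2
  refine ⟨s, ?_, hsum, hs⟩
  have key : ∀ s : Fin 5 → ℤˣ, (4 : ℤ) ∣ 3 + ∑ i, (s i : ℤ) → ∏ i, s i = 1 := by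
    decide +kernel
  exact key s ⟨_, hsum.symm⟩

theorem exists_isMinusOneClass_of_signs {s : Fin 5 → ℤˣ} (hs : ∏ i, s i = 1) :
    ∃ E : Fin 6 → ℤ, IsMinusOneClass (n := 5) E ∧ 4 * E 0 = 3 + ∑ i, (s i : ℤ) ∧
      ∀ i, (s i : ℤ) = 2 * E i.succ + 2 * E 0 - 1 := by
  let E (s : Fin 5 → ℤˣ) : Fin 6 → ℤ :=
    Fin.cons ((3 + ∑ i, (s i : ℤ)) / 4) fun i => (2 * s i - 1 - ∑ i, (s i : ℤ)) / 4
  have key : ∀ s : Fin 5 → ℤˣ, ∏ i, s i = 1 →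
      (interZ (n := 5) (E s) (E s) = -1 ∧ interZ (antiK 5) (E s) = 1) ∧
      4 * E s 0 = 3 + ∑ i, (s i : ℤ) ∧ ∀ i, (s i : ℤ) = 2 * E s i.succ + 2 * E s 0 - 1 := by
    decide +kernel
  exact ⟨E s, key s hs⟩

theorem mem_nefCone_five_iff (x : Fin 6 → ℝ) :
    x ∈ NefCone 5 ↔
      (fun i : Fin 5 => conicMap x i.succ) ∈ halfSpinPolytope 5 1 (interR (antiKR 5) x) := by
  constructor
  · intro hx s hs
    obtain ⟨E, hE, h0, hsE⟩ := exists_isMinusOneClass_of_signs hs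
    linarith [hx E hE, four_mul_interR h0 hsE x]
  · intro hx E hE
    obtain ⟨s, hs, h0, hsE⟩ := exists_signs_of_isMinusOneClass hE
    linarith [hx s hs, four_mul_interR h0 hsE x]

theorem volume_truncated_halfSpin_cone :
    volume {y : Fin 6 → ℝ | (fun i : Fin 5 => y i.succ) ∈ halfSpinPolytope 5 1 (y 0) ∧
      0 ≤ y 0 ∧ y 0 ≤ 1} = ENNReal.ofReal (8 / 135) := by
  have hmeas : MeasurableSet {y : Fin 6 → ℝ |
      (fun i : Fin 5 => y i.succ) ∈ halfSpinPolytope 5 1 (y 0) ∧ 0 ≤ y 0 ∧ y 0 ≤ 1} := by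
    have h0 : IsClosed {y : Fin 6 → ℝ | 0 ≤ y 0} := isClosed_le (by fun_prop) (by fun_prop)
    have h1 : IsClosed {y : Fin 6 → ℝ | y 0 ≤ 1} := isClosed_le (by fun_prop) (by fun_prop)
    refine (IsClosed.inter (s₁ := {y : Fin 6 → ℝ | ∀ s : Fin 5 → ℤˣ, ∏ i, s i = 1 →
      ∑ i, ((s i : ℤ) : ℝ) * y i.succ ≤ y 0}) ?_ (h0.inter h1)).measurableSet
    simp only [ofPred_forall]
    exact isClosed_iInter fun s => isClosed_iInter fun _ =>
      isClosed_le (by fun_prop) (by fun_prop)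
  rw [volume_eq_lintegral_insertNth 0 hmeas]
  have hslice : ∀ t : ℝ, volume {w : Fin 5 → ℝ | (0 : Fin 6).insertNth t w ∈ {y : Fin 6 → ℝ |
      (fun i : Fin 5 => y i.succ) ∈ halfSpinPolytope 5 1 (y 0) ∧ 0 ≤ y 0 ∧ y 0 ≤ 1}} =
      (Icc (0 : ℝ) 1).indicator (fun t => ENNReal.ofReal (16 / 45 * t ^ 5)) t := by
    intro t
    by_cases ht : t ∈ Icc (0 : ℝ) 1
    · rw [indicator_of_mem ht, ← volume_halfSpinPolytope_five ht.1]
      congr 1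
      ext w
      simp [ht.1, ht.2]
    · rw [indicator_of_notMem ht]
      convert measure_empty (μ := volume)
      ext w
      have : ¬(0 ≤ t ∧ t ≤ 1) := ht
      simp [this]
  rw [lintegral_congr hslice, lintegral_indicator measurableSet_Icc,
    ← ofReal_integral_eq_lintegral_ofReal]
  · rw [integral_Icc_eq_integral_Ioc, ← intervalIntegral.integral_of_le zero_le_one,
      intervalIntegral.integral_const_mul, integral_pow]
    norm_num
  · exact (by fun_prop : Continuous fun t : ℝ => 16 / 45 * t ^ 5).continuousOn.integrableOn_Icc
  · filter_upwards [ae_restrict_mem measurableSet_Icc] with t ht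
    have := ht.1
    positivity

theorem alpha_S5 :
    6 * (volume {x : Fin (5 + 1) → ℝ | x ∈ NefCone 5 ∧
      0 ≤ interR (antiKR 5) x ∧ interR (antiKR 5) x ≤ 1}).toReal = 1 / 180 := by
  have h : {x : Fin (5 + 1) → ℝ | x ∈ NefCone 5 ∧
      0 ≤ interR (antiKR 5) x ∧ interR (antiKR 5) x ≤ 1} = conicMap ⁻¹' {y : Fin 6 → ℝ |
      (fun i : Fin 5 => y i.succ) ∈ halfSpinPolytope 5 1 (y 0) ∧ 0 ≤ y 0 ∧ y 0 ≤ 1} := by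
    ext x
    simp only [mem_ofPred_eq, mem_preimage, conicMap_zero]
    rw [mem_nefCone_five_iff]
  rw [h, Measure.addHaar_preimage_linearMap _ (by rw [det_conicMap]; norm_num), det_conicMap,
    volume_truncated_halfSpin_cone, ENNReal.toReal_mul, ENNReal.toReal_ofReal (abs_nonneg _),
    ENNReal.toReal_ofReal (by norm_num)]
  rw [abs_of_neg (by norm_num)]
  norm_num
end
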